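/- The field extension K = ℚ(a,b,c,d,e,f) over its subfield ℚ(s_1, t_1, s_2, t_2, s_*, t_*) generated by the line coordinates of the Pascal lines ℓ_1, ℓ_2, ℓ_* has degree exactly 12. -/

import Mathlib

noncomputable section

/-- `K = ℚ(a,b,c,d,e,f)`, the field of rational functions in six variables over ℚ. -/
abbrev RatField : Type := FractionRing (MvPolynomial (Fin 6) ℚ)

/-- The six independent variables `a, b, c, d, e, f` (indexed `0,…,5`) as elements of
`ℚ(a,…,f)`. -/
def var (i : Fin 6) : RatField :=
  algebraMap (MvPolynomial (Fin 6) ℚ) RatField (MvPolynomial.X i)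

/-- The point `[1, p, p²]` of the conic `z1² = z0·z2`, in homogeneous coordinates. -/
def conicPt (p : RatField) : Fin 3 → RatField := ![1, p, p ^ 2]

/-- Cross product of coordinate vectors: the coordinates of the join of two points, or of
the intersection of two lines. -/
def cross (u v : Fin 3 → RatField) : Fin 3 → RatField :=
  ![u 1 * v 2 - u 2 * v 1, u 2 * v 0 - u 0 * v 2, u 0 * v 1 - u 1 * v 0]

/-- The homogeneous coordinate vector of the Pascal line of the array
`[P1 P2 P3; Q1 Q2 Q3]` of points of the conic with parameters `p1, p2, p3, q1, q2, q3`: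
the line through the (collinear) points `P1Q2 ∩ P2Q1`, `P2Q3 ∩ P3Q2`, `P1Q3 ∩ P3Q1`,
computed as the join of the first two of them. -/
def pascalVec (p1 p2 p3 q1 q2 q3 : RatField) : Fin 3 → RatField :=
  cross
    (cross (cross (conicPt p1) (conicPt q2)) (cross (conicPt p2) (conicPt q1)))
    (cross (cross (conicPt p2) (conicPt q3)) (cross (conicPt p3) (conicPt q2)))

/-- The coordinate `s` of a line with coordinates `⟨1, s, t⟩`, i.e. the line
`z0 + s·z1 + t·z2 = 0`. -/
def sCoord (l : Fin 3 → RatField) : RatField := l 1 / l 0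

/-- The coordinate `t` of a line with coordinates `⟨1, s, t⟩`, i.e. the line
`z0 + s·z1 + t·z2 = 0`. -/
def tCoord (l : Fin 3 → RatField) : RatField := l 2 / l 0

/-- The Pascal `ℓ₁` of the array `[A D B; E C F]`. -/
def line1 : Fin 3 → RatField := pascalVec (var 0) (var 3) (var 1) (var 4) (var 2) (var 5)

/-- The Pascal `ℓ₂` of the array `[A C F; E D B]`. -/
def line2 : Fin 3 → RatField := pascalVec (var 0) (var 2) (var 5) (var 4) (var 3) (var 1)

/-- The Pascal `ℓ₃` of the array `[A D F; E C B]`. -/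
def line3 : Fin 3 → RatField := pascalVec (var 0) (var 3) (var 5) (var 4) (var 2) (var 1)

/-- The Pascal `ℓ⋆` of the array `[A B C; F D E]`. -/
def lineStar : Fin 3 → RatField :=
  pascalVec (var 0) (var 1) (var 2) (var 5) (var 3) (var 4)
open Polynomial in
/-- Irreducibility over the fraction field of a factorial domain can be checked after a
specialization preserving the degree. -/
theorem irreducible_map_fraction_of_specialization {A K k : Type*} [CommRing A] [IsDomain A]
    [UniqueFactorizationMonoid A] [Field K] [Algebra A K] [IsFractionRing A K] [Field k]
    (φ : A →+* k) (f : A[X]) (hdeg : f.natDegree ≤ (f.map φ).natDegree)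
    (hirr : Irreducible (f.map φ)) : Irreducible (f.map (algebraMap A K)) := by
  classical
  let _ : NormalizedGCDMonoid A := Classical.choice inferInstance
  have hf0 : f ≠ 0 := by rintro rfl; simp at hirr
  have hc0 : f.content ≠ 0 := by simpa [content_eq_zero_iff] using hf0
  set g := f.primPart with hg
  have hfg : f = C f.content * g := f.eq_C_content_mul_primPart
  have hmap : f.map φ = C (φ f.content) * g.map φ := by
    conv_lhs => rw [hfg]
    simp
  have hφc : φ f.content ≠ 0 := by
    intro h0
    rw [hmap, h0] at hirr
    simp at hirr
  have hgirr : Irreducible (g.map φ) := by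
    rw [hmap] at hirr
    exact (irreducible_isUnit_mul (isUnit_C.2 hφc.isUnit)).1 hirr
  have hgdeg : g.natDegree ≤ (g.map φ).natDegree := by
    rw [hmap, natDegree_C_mul hφc] at hdeg
    rw [hfg, natDegree_C_mul hc0] at hdeg
    exact hdeg
  have hprim : g.IsPrimitive := f.isPrimitive_primPart
  have key : ∀ p q : A[X], g = p * q → IsUnit (p.map φ) → IsUnit p := by
    intro p q hpq hu
    have hp0 : p ≠ 0 := by rintro rfl; simp at hu
    have hg0 : g ≠ 0 := hprim.ne_zero
    have hq0 : q ≠ 0 := by rintro rfl; simp at hpq; exact hg0 hpq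
    have h1 : (p.map φ).natDegree = 0 := natDegree_eq_zero_of_isUnit hu
    have h2 : g.natDegree = p.natDegree + q.natDegree := by rw [hpq, natDegree_mul hp0 hq0]
    have h3 : (g.map φ).natDegree ≤ (p.map φ).natDegree + (q.map φ).natDegree := by
      rw [hpq, Polynomial.map_mul]; exact natDegree_mul_le
    have h4 : (q.map φ).natDegree ≤ q.natDegree := natDegree_map_le
    have h5 : p.natDegree = 0 := by omega
    rw [natDegree_eq_zero] at h5
    obtain ⟨c, rfl⟩ := h5
    exact isUnit_C.2 (hprim c ⟨q, hpq⟩)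
  have hgA : Irreducible g := by
    refine ⟨fun h => hgirr.not_isUnit (h.map (mapRingHom φ)), fun p q hpq => ?_⟩
    have h1 : g.map φ = p.map φ * q.map φ := by rw [hpq, Polynomial.map_mul]
    rcases hgirr.isUnit_or_isUnit h1 with h | h
    · exact Or.inl (key p q hpq h)
    · exact Or.inr (key q p (by rw [hpq, mul_comm]) h)
  have hgK : Irreducible (g.map (algebraMap A K)) :=
    (hprim.irreducible_iff_irreducible_map_fraction_map (K := K)).1 hgA
  have hcK : algebraMap A K f.content ≠ 0 := by
    simpa using hc0
  have : f.map (algebraMap A K) = C (algebraMap A K f.content) * g.map (algebraMap A K) := by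
    conv_lhs => rw [hfg]
    simp
  rw [this]
  exact (irreducible_isUnit_mul (isUnit_C.2 hcK.isUnit)).2 hgK

open Polynomial in
/-- The degree of a simple extension of subfields, from an irreducible polynomial. -/
theorem relfinrank_sup_closure_singleton {F : Type*} [Field F] (E : Subfield F) (x : F) (p : E[X])
    (hirr : Irreducible p) (hx : aeval x p = 0) :
    Subfield.relfinrank E (E ⊔ Subfield.closure {x}) = p.natDegree := by
  have hle : E ≤ E ⊔ Subfield.closure {x} := le_sup_left
  rw [Subfield.relfinrank_eq_finrank_of_le hle]
  have hext : Subfield.extendScalars hle = IntermediateField.adjoin E {x} := by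
    apply le_antisymm
    · intro z hz
      rw [Subfield.mem_extendScalars] at hz
      have h : E ⊔ Subfield.closure {x} ≤ (IntermediateField.adjoin E {x}).toSubfield := by
        refine sup_le (fun y hy => ?_) (Subfield.closure_le.2 ?_)
        · exact (IntermediateField.adjoin E {x}).algebraMap_mem ⟨y, hy⟩
        · rintro _ rfl
          exact IntermediateField.mem_adjoin_simple_self E _
      exact h hz
    · rw [IntermediateField.adjoin_simple_le_iff, Subfield.mem_extendScalars]
      exact (le_sup_right : Subfield.closure {x} ≤ E ⊔ Subfield.closure {x})
        (Subfield.subset_closure rfl)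
  have hint : IsIntegral E x := IsAlgebraic.isIntegral ⟨p, hirr.ne_zero, hx⟩
  rw [hext, IntermediateField.adjoin.finrank hint, ← minpoly.eq_of_irreducible hirr hx,
    natDegree_mul_C (inv_ne_zero (leadingCoeff_ne_zero.2 hirr.ne_zero))]

open Polynomial in
theorem relfinrank_sup_closure_sqrt {F : Type*} [Field F] (E : Subfield F) (x : F) (hx : x ∉ E)
    (hx2 : x ^ 2 ∈ E) : Subfield.relfinrank E (E ⊔ Subfield.closure {x}) = 2 := by
  have hirr : Irreducible (X ^ 2 - C (⟨x ^ 2, hx2⟩ : E)) := by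
    rw [X_pow_sub_C_irreducible_iff_of_prime Nat.prime_two]
    intro y hy
    have h : x ^ 2 = (y : F) ^ 2 := (congrArg Subtype.val hy).symm
    rcases sq_eq_sq_iff_eq_or_eq_neg.1 h with h | h
    · exact hx (h ▸ y.2)
    · exact hx (h ▸ neg_mem y.2)
  rw [relfinrank_sup_closure_singleton E x _ hirr, natDegree_X_pow_sub_C]
  rw [map_sub, map_pow, aeval_X, aeval_C]
  exact sub_self _

theorem trdeg_ratField : Algebra.trdeg ℚ RatField = 6 := by
  have := IsFractionRing.comap_isAlgebraic_iff (A := MvPolynomial (Fin 6) ℚ) (K := RatField)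
    (C := RatField) |>.2 inferInstance
  rw [← trdeg_add_eq ℚ (MvPolynomial (Fin 6) ℚ) (A := RatField),
    MvPolynomial.trdeg_of_isDomain, trdeg_eq_zero_iff.2 this]
  simp

open Polynomial in
/-- Six elements over which `RatField` is finite, generated by one algebraic element, are
algebraically independent. -/
theorem algebraicIndependent_of_isAlgebraic (y : Fin 6 → RatField) (x : RatField)
    (hx : IsAlgebraic (Subfield.closure (Set.range y)) x)
    (h : Subfield.closure (Set.range y) ⊔ Subfield.closure {x} = ⊤) :
    AlgebraicIndependent ℚ y := by
  obtain ⟨K, hK⟩ : ∃ K, K = IntermediateField.adjoin ℚ (Set.range y) := ⟨_, rfl⟩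
  have hle : Subfield.closure (Set.range y) ≤ K.toSubfield :=
    hK ▸ Subfield.closure_le.2 (IntermediateField.subset_adjoin ℚ _)
  have hxK : IsAlgebraic K x := by
    obtain ⟨p, hp0, hp⟩ := hx
    let i : Subfield.closure (Set.range y) →+* K := Subfield.inclusion hle
    refine ⟨p.map i, (Polynomial.map_ne_zero_iff i.injective).2 hp0, ?_⟩
    rw [aeval_def, eval₂_map]
    exact hp
  have htop : IntermediateField.adjoin K {x} = ⊤ := by
    rw [eq_top_iff]
    intro z _
    have h1 : Subfield.closure (Set.range y) ⊔ Subfield.closure {x} ≤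
        (IntermediateField.adjoin K {x}).toSubfield := by
      refine sup_le (fun w hw => ?_) (Subfield.closure_le.2 ?_)
      · exact (IntermediateField.adjoin K {x}).algebraMap_mem ⟨w, hle hw⟩
      · rintro _ rfl
        exact IntermediateField.mem_adjoin_simple_self K _
    exact h1 (h ▸ Subfield.mem_top z)
  have halg : Algebra.IsAlgebraic K RatField := by
    have h1 := IntermediateField.isAlgebraic_adjoin_simple hxK.isIntegral
    rw [htop] at h1
    exact (IntermediateField.topEquiv (F := K) (E := RatField)).isAlgebraic_iff.1 h1
  subst hK
  have halg' : Algebra.IsAlgebraic (Algebra.adjoin ℚ (Set.range y)) RatField := by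
    open scoped IntermediateField.algebraAdjoinAdjoin in
    exact (IsFractionRing.comap_isAlgebraic_iff (A := Algebra.adjoin ℚ (Set.range y))
      (K := IntermediateField.adjoin ℚ (Set.range y))
      (C := RatField)).2 halg
  exact (Algebra.IsAlgebraic.isTranscendenceBasis_of_le_trdeg_of_finite ℚ y
    (by rw [trdeg_ratField]; simp)).1

theorem exists_ringHom_var (y : Fin 6 → RatField) (h : AlgebraicIndependent ℚ y) :
    ∃ φ : RatField →+* RatField, ∀ i, φ (var i) = y i := by
  have hinj : Function.Injective
      (MvPolynomial.aeval y : MvPolynomial (Fin 6) ℚ →ₐ[ℚ] RatField).toRingHom := h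
  refine ⟨IsFractionRing.lift hinj, fun i => ?_⟩
  rw [var, IsFractionRing.lift_algebraMap]
  simp

theorem frobenius_iterate_ne {K : Type*} [Field K] [CharP K 7] (x : K)
    (hf : 1 + x + 2 * x ^ 2 + 5 * x ^ 3 + 2 * x ^ 4 + 3 * x ^ 5 + 2 * x ^ 6 + 3 * x ^ 7 + x ^ 9 +
      5 * x ^ 10 + x ^ 11 + 6 * x ^ 12 = 0) :
    x ^ 7 ^ 4 ≠ x ∧ x ^ 7 ^ 5 ≠ x ∧ x ^ 7 ^ 6 ≠ x := by
  have _ : Fact (Nat.Prime 7) := ⟨by norm_num⟩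
  have h7 : (7 : K) = 0 := by exact_mod_cast CharP.cast_eq_zero K 7
  have hfrob (i : ℕ) (z : K) (h : x ^ 7 ^ i = z) : x ^ 7 ^ (i + 1) = frobenius K 7 z := by
    rw [← h, frobenius_def, pow_succ, pow_mul]
  have e2 : (x ^ 7) ^ 2 = 6 + 5 * x ^ 3 + 5 * x ^ 4 + 4 * x ^ 5 + 3 * x ^ 6 + 2 * x ^ 7 +
      5 * x ^ 8 + 2 * x ^ 9 + 3 * x ^ 10 + 5 * x ^ 11 := by
    linear_combination (1 + 6 * x + 6 * x ^ 2) * hf + (-1 - x - 2 * x ^ 2 - 4 * x ^ 3 - 7 * x ^ 4 -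
        7 * x ^ 5 - 5 * x ^ 6 - 5 * x ^ 7 - 5 * x ^ 8 - 3 * x ^ 9 - 2 * x ^ 10 - 6 * x ^ 11 -
        6 * x ^ 12 - 6 * x ^ 13 - 5 * x ^ 14) * h7
  have e3 : (x ^ 7) ^ 3 = 2 + x + 6 * x ^ 3 + x ^ 4 + 6 * x ^ 5 + 6 * x ^ 6 + 3 * x ^ 7 +
      2 * x ^ 8 + x ^ 9 + 2 * x ^ 10 + 2 * x ^ 11 := by
    linear_combination x ^ 7 * e2 + (5 + x + 3 * x ^ 2 + 6 * x ^ 3 + 6 * x ^ 5 + 2 * x ^ 6) * hf +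
        (-1 - x - 2 * x ^ 2 - 6 * x ^ 3 - 4 * x ^ 4 - 8 * x ^ 5 - 9 * x ^ 6 - 7 * x ^ 7 -
        9 * x ^ 8 - 7 * x ^ 9 - 9 * x ^ 10 - 4 * x ^ 11 - 10 * x ^ 12 - 6 * x ^ 13 - 4 * x ^ 14 -
        9 * x ^ 15 - 2 * x ^ 16 - 5 * x ^ 17 - x ^ 18) * h7
  have e4 : (x ^ 7) ^ 4 = 1 + x + 4 * x ^ 2 + 4 * x ^ 3 + 4 * x ^ 4 + 5 * x ^ 5 + 6 * x ^ 6 +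
      6 * x ^ 7 + x ^ 8 + x ^ 9 + 6 * x ^ 10 := by
    linear_combination x ^ 7 * e3 + (6 + 5 * x ^ 2 + 3 * x ^ 3 + 6 * x ^ 4 + 3 * x ^ 5 +
        5 * x ^ 6) * hf + (-1 - x - 3 * x ^ 2 - 6 * x ^ 3 - 5 * x ^ 4 - 9 * x ^ 5 - 9 * x ^ 6 -
        12 * x ^ 7 - 8 * x ^ 8 - 11 * x ^ 9 - 10 * x ^ 10 - 7 * x ^ 11 - 11 * x ^ 12 - 5 * x ^ 13 -
        9 * x ^ 14 - 6 * x ^ 15 - 9 * x ^ 16 - 3 * x ^ 17 - 4 * x ^ 18) * h7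
  have e5 : (x ^ 7) ^ 5 = 4 + 5 * x + 3 * x ^ 2 + 5 * x ^ 3 + 4 * x ^ 4 + 3 * x ^ 5 + 6 * x ^ 6 +
      x ^ 7 + 3 * x ^ 8 + x ^ 9 + 3 * x ^ 10 + 5 * x ^ 11 := by
    linear_combination x ^ 7 * e4 + (3 + 6 * x + 6 * x ^ 2 + 4 * x ^ 3 + x ^ 5) * hf + (-1 - 2 * x -
        3 * x ^ 2 - 6 * x ^ 3 - 8 * x ^ 4 - 9 * x ^ 5 - 9 * x ^ 6 - 7 * x ^ 7 - 7 * x ^ 8 -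
        4 * x ^ 9 - 5 * x ^ 10 - 6 * x ^ 11 - 8 * x ^ 12 - 8 * x ^ 13 - 5 * x ^ 14 -
        4 * x ^ 15) * h7
  have e6 : (x ^ 7) ^ 6 = 1 + 6 * x + 2 * x ^ 2 + x ^ 3 + 5 * x ^ 5 + x ^ 6 + 3 * x ^ 8 +
      2 * x ^ 9 + 6 * x ^ 10 + 4 * x ^ 11 := by
    linear_combination x ^ 7 * e5 + (6 + 2 * x + 5 * x ^ 2 + 2 * x ^ 3 + x ^ 4 + 6 * x ^ 5 +
        2 * x ^ 6) * hf + (-1 - 2 * x - 3 * x ^ 2 - 6 * x ^ 3 - 5 * x ^ 4 - 9 * x ^ 5 - 7 * x ^ 6 -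
        8 * x ^ 7 - 8 * x ^ 8 - 7 * x ^ 9 - 9 * x ^ 10 - 6 * x ^ 11 - 12 * x ^ 12 - 4 * x ^ 13 -
        6 * x ^ 14 - 6 * x ^ 15 - 3 * x ^ 16 - 5 * x ^ 17 - x ^ 18) * h7
  have e7 : (x ^ 7) ^ 7 = 6 + 6 * x + 5 * x ^ 2 + 3 * x ^ 6 + 3 * x ^ 7 + 3 * x ^ 8 + x ^ 10 +
      x ^ 11 := by
    linear_combination x ^ 7 * e6 + (1 + 2 * x ^ 3 + 3 * x ^ 4 + 4 * x ^ 5 + 3 * x ^ 6) * hf + (-1 -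
        x - x ^ 2 - x ^ 3 - x ^ 4 - 2 * x ^ 5 - 4 * x ^ 6 - 5 * x ^ 7 - 5 * x ^ 8 - 5 * x ^ 9 -
        5 * x ^ 10 - 4 * x ^ 11 - 3 * x ^ 12 - 3 * x ^ 13 - 3 * x ^ 14 - 5 * x ^ 15 - 5 * x ^ 16 -
        3 * x ^ 17 - 2 * x ^ 18) * h7
  have e8 : (x ^ 7) ^ 8 = 2 + 6 * x + 6 * x ^ 2 + 2 * x ^ 3 + 6 * x ^ 4 + 6 * x ^ 5 + x ^ 6 +
      5 * x ^ 7 + 5 * x ^ 8 + 3 * x ^ 9 + x ^ 10 + 6 * x ^ 11 := by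
    linear_combination x ^ 7 * e7 + (5 + 3 * x + 2 * x ^ 2 + 5 * x ^ 5 + 6 * x ^ 6) * hf + (-1 -
        2 * x - 3 * x ^ 2 - 5 * x ^ 3 - 5 * x ^ 4 - 6 * x ^ 5 - 5 * x ^ 6 - 6 * x ^ 7 - 7 * x ^ 8 -
        7 * x ^ 9 - 8 * x ^ 10 - 8 * x ^ 11 - 10 * x ^ 12 - 5 * x ^ 13 - 2 * x ^ 14 - 4 * x ^ 15 -
        5 * x ^ 16 - 5 * x ^ 17 - 5 * x ^ 18) * h7
  have e9 : (x ^ 7) ^ 9 = 1 + 4 * x + 2 * x ^ 2 + 3 * x ^ 3 + 4 * x ^ 4 + 3 * x ^ 5 + 3 * x ^ 6 +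
      2 * x ^ 7 + 2 * x ^ 8 + 5 * x ^ 9 + 3 * x ^ 10 + 3 * x ^ 11 := by
    linear_combination x ^ 7 * e8 + (6 + 4 * x + 3 * x ^ 2 + 5 * x ^ 3 + 2 * x ^ 4 + x ^ 6) * hf +
        (-1 - 2 * x - 3 * x ^ 2 - 7 * x ^ 3 - 7 * x ^ 4 - 8 * x ^ 5 - 9 * x ^ 6 - 8 * x ^ 7 -
        5 * x ^ 8 - 5 * x ^ 9 - 8 * x ^ 10 - 5 * x ^ 11 - 8 * x ^ 12 - 8 * x ^ 13 - 4 * x ^ 14 -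
        4 * x ^ 15 - 2 * x ^ 16) * h7
  have e10 : (x ^ 7) ^ 10 = 1 + 4 * x + x ^ 2 + 5 * x ^ 3 + 5 * x ^ 4 + 3 * x ^ 5 + 5 * x ^ 6 +
      6 * x ^ 7 + 3 * x ^ 8 + x ^ 9 + 4 * x ^ 10 + 3 * x ^ 11 := by
    linear_combination x ^ 7 * e9 + (6 + 4 * x + 4 * x ^ 2 + 2 * x ^ 3 + 2 * x ^ 4 + x ^ 5 +
        4 * x ^ 6) * hf + (-1 - 2 * x - 3 * x ^ 2 - 7 * x ^ 3 - 7 * x ^ 4 - 8 * x ^ 5 - 8 * x ^ 6 -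
        9 * x ^ 7 - 6 * x ^ 8 - 7 * x ^ 9 - 8 * x ^ 10 - 7 * x ^ 11 - 10 * x ^ 12 - 7 * x ^ 13 -
        5 * x ^ 14 - 3 * x ^ 15 - 4 * x ^ 16 - x ^ 17 - 3 * x ^ 18) * h7
  have e11 : (x ^ 7) ^ 11 = 3 * x + 6 * x ^ 2 + 3 * x ^ 3 + 3 * x ^ 4 + 4 * x ^ 5 + 6 * x ^ 6 +
      3 * x ^ 7 + 4 * x ^ 8 + 5 * x ^ 9 + 3 * x ^ 11 := by
    linear_combination x ^ 7 * e10 + (4 * x + 4 * x ^ 2 + 6 * x ^ 3 + 5 * x ^ 4 + 4 * x ^ 6) * hf +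
        (-x - 2 * x ^ 2 - 3 * x ^ 3 - 6 * x ^ 4 - 7 * x ^ 5 - 10 * x ^ 6 - 9 * x ^ 7 - 8 * x ^ 8 -
        9 * x ^ 9 - 5 * x ^ 10 - 7 * x ^ 11 - 5 * x ^ 12 - 10 * x ^ 13 - 7 * x ^ 14 - 6 * x ^ 15 -
        7 * x ^ 16 - 3 * x ^ 18) * h7
  have p1 : x ^ 7 ^ 1 = x ^ 7 := by norm_num
  have p2 : x ^ 7 ^ 2 = 6 + 6 * x + 5 * x ^ 2 + 3 * x ^ 6 + 3 * x ^ 7 + 3 * x ^ 8 + x ^ 10 +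
      x ^ 11 := by
    have h := hfrob _ _ p1
    simp only [map_pow, frobenius_def] at h
    linear_combination h + e7
  have p3 : x ^ 7 ^ 3 = 1 + 5 * x + 4 * x ^ 2 + 2 * x ^ 4 + 4 * x ^ 5 + 6 * x ^ 6 + 2 * x ^ 8 +
      3 * x ^ 9 + x ^ 10 + x ^ 11 := by
    have h := hfrob _ _ p2
    simp only [map_add, map_mul, map_pow, map_ofNat, frobenius_def] at h
    linear_combination h + 5 * e2 + 3 * e6 + 3 * e7 + 3 * e8 + e10 + e11 + (9 + 8 * x +
        6 * x ^ 2 + 6 * x ^ 3 + 7 * x ^ 4 + 8 * x ^ 5 + 5 * x ^ 6 + 7 * x ^ 7 + 9 * x ^ 8 +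
        4 * x ^ 9 + 6 * x ^ 10 + 9 * x ^ 11) * h7
  have p4 : x ^ 7 ^ 4 = 1 + 5 * x + x ^ 2 + 5 * x ^ 3 + 6 * x ^ 4 + 5 * x ^ 5 + 6 * x ^ 6 +
      5 * x ^ 7 + 5 * x ^ 8 + 4 * x ^ 9 + 3 * x ^ 10 := by
    have h := hfrob _ _ p3
    simp only [map_add, map_mul, map_pow, map_ofNat, frobenius_def] at h
    linear_combination h + 4 * e2 + 2 * e4 + 4 * e5 + 6 * e6 + 2 * e8 + 3 * e9 + e10 + e11 +
        (8 + 12 * x + 8 * x ^ 2 + 10 * x ^ 3 + 10 * x ^ 4 + 13 * x ^ 5 + 10 * x ^ 6 + 7 * x ^ 7 +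
        10 * x ^ 8 + 7 * x ^ 9 + 12 * x ^ 10 + 13 * x ^ 11) * h7
  have p5 : x ^ 7 ^ 5 = 5 + 6 * x + 5 * x ^ 2 + x ^ 3 + 3 * x ^ 4 + 6 * x ^ 5 + 5 * x ^ 6 +
      3 * x ^ 7 + 6 * x ^ 8 + 5 * x ^ 9 + x ^ 10 + x ^ 11 := by
    have h := hfrob _ _ p4
    simp only [map_add, map_mul, map_pow, map_ofNat, frobenius_def] at h
    linear_combination h + e2 + 5 * e3 + 6 * e4 + 5 * e5 + 6 * e6 + 5 * e7 + 5 * e8 + 4 * e9 +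
        3 * e10 + (13 + 22 * x + 16 * x ^ 2 + 18 * x ^ 3 + 16 * x ^ 4 + 22 * x ^ 5 + 21 * x ^ 6 +
        18 * x ^ 7 + 15 * x ^ 8 + 9 * x ^ 9 + 19 * x ^ 10 + 17 * x ^ 11) * h7
  have p6 : x ^ 7 ^ 6 = 5 * x + 3 * x ^ 2 + x ^ 3 + 2 * x ^ 5 + 2 * x ^ 6 + 3 * x ^ 7 + 2 * x ^ 9 +
      6 * x ^ 10 + 4 * x ^ 11 := by
    have h := hfrob _ _ p5
    simp only [map_add, map_mul, map_pow, map_ofNat, frobenius_def] at h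
    linear_combination h + 5 * e2 + e3 + 3 * e4 + 6 * e5 + 5 * e6 + 3 * e7 + 6 * e8 + 5 * e9 +
        1 * e10 + e11 + (15 + 20 * x + 15 * x ^ 2 + 16 * x ^ 3 + 18 * x ^ 4 + 20 * x ^ 5 +
        17 * x ^ 6 + 14 * x ^ 7 + 17 * x ^ 8 + 11 * x ^ 9 + 15 * x ^ 10 + 19 * x ^ 11) * h7
  refine ⟨?_, ?_, ?_⟩
  · intro h
    refine one_ne_zero (α := K) ?_
    linear_combination (6 + 5 * x + 2 * x ^ 2 + x ^ 6 + 2 * x ^ 7 + 3 * x ^ 8 + x ^ 9) * hf + (2 +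
        2 * x + 6 * x ^ 2 + 6 * x ^ 3 + 5 * x ^ 4 + 3 * x ^ 5 + 3 * x ^ 6 + 3 * x ^ 7 + 3 * x ^ 8 +
        x ^ 10 + 5 * x ^ 11) * (h - p4) - (1 + 3 * x + 5 * x ^ 2 + 12 * x ^ 3 + 14 * x ^ 4 +
        17 * x ^ 5 + 20 * x ^ 6 + 24 * x ^ 7 + 25 * x ^ 8 + 26 * x ^ 9 + 30 * x ^ 10 + 31 * x ^ 11 +
        32 * x ^ 12 + 23 * x ^ 13 + 19 * x ^ 14 + 14 * x ^ 15 + 11 * x ^ 16 + 10 * x ^ 17 +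
        9 * x ^ 18 + 7 * x ^ 19 + 6 * x ^ 20 + 3 * x ^ 21) * h7
  · intro h
    refine one_ne_zero (α := K) ?_
    linear_combination (2 + 4 * x + 2 * x ^ 2 + 4 * x ^ 3 + 5 * x ^ 4 + 5 * x ^ 5 + x ^ 6 +
        4 * x ^ 7 + 2 * x ^ 8 + 2 * x ^ 10) * hf + (4 + 6 * x + 2 * x ^ 2 + 6 * x ^ 3 + 2 * x ^ 4 +
        4 * x ^ 6 + 4 * x ^ 7 + x ^ 8 + 3 * x ^ 10 + 2 * x ^ 11) * (h - p5) - (3 + 8 * x +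
        10 * x ^ 2 + 14 * x ^ 3 + 15 * x ^ 4 + 18 * x ^ 5 + 22 * x ^ 6 + 26 * x ^ 7 + 30 * x ^ 8 +
        27 * x ^ 9 + 27 * x ^ 10 + 28 * x ^ 11 + 27 * x ^ 12 + 21 * x ^ 13 + 18 * x ^ 14 +
        20 * x ^ 15 + 15 * x ^ 16 + 13 * x ^ 17 + 7 * x ^ 18 + 8 * x ^ 19 + 5 * x ^ 20 + x ^ 21 +
        2 * x ^ 22) * h7
  · intro h
    refine one_ne_zero (α := K) ?_
    linear_combination (1 + 5 * x ^ 2 + 5 * x ^ 3 + x ^ 4 + 2 * x ^ 5 + 5 * x ^ 6 + 2 * x ^ 7 +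
        4 * x ^ 8 + 3 * x ^ 9 + 6 * x ^ 10) * hf + (5 + 5 * x + 3 * x ^ 3 + 6 * x ^ 4 + x ^ 5 +
        5 * x ^ 6 + 2 * x ^ 7 + x ^ 8 + 4 * x ^ 10 + 5 * x ^ 11) * (h - p6) - (3 * x + 6 * x ^ 2 +
        5 * x ^ 3 + 5 * x ^ 4 + 12 * x ^ 5 + 13 * x ^ 6 + 14 * x ^ 7 + 14 * x ^ 8 + 16 * x ^ 9 +
        19 * x ^ 10 + 23 * x ^ 11 + 24 * x ^ 12 + 24 * x ^ 13 + 20 * x ^ 14 + 19 * x ^ 15 +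
        16 * x ^ 16 + 15 * x ^ 17 + 12 * x ^ 18 + 7 * x ^ 19 + 13 * x ^ 20 + 10 * x ^ 21 +
        8 * x ^ 22) * h7

/-- The value at `ρ` of the resolvent of degree `12`. -/
def rhoPolyVal {A : Type*} [CommRing A] (T₁ T₂ t s ρ : A) : A :=
  let M := 1 + ρ
  let N := 1 - ρ
  let n := ρ * T₁ + T₂
  let P := ρ * T₁ - T₂
  let E := ρ ^ 2 * T₁ - T₂
  let E' := ρ ^ 2 * T₁ + T₂
  let D := M - t * n
  let q := M + 3 * t * n
  let G := 3 * N * M - 2 * t * E - 3 * t ^ 2 * n * P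
  let Δ := q ^ 2 * E - 4 * n * N * (M ^ 2 - t ^ 2 * n ^ 2)
  (E * G ^ 2 + Δ * D ^ 2 + 2 * s ^ 2 * E * E' * D ^ 2) ^ 2 -
    4 * D ^ 2 * E * Δ * (s ^ 2 * E - G) ^ 2

open Polynomial in
/-- The resolvent as a polynomial in `ρ`. -/
def rhoPoly {A : Type*} [CommRing A] (T₁ T₂ t s : A) : A[X] :=
  rhoPolyVal (C T₁) (C T₂) (C t) (C s) X

theorem map_rhoPolyVal {A B : Type*} [CommRing A] [CommRing B] (φ : A →+* B)
    (T₁ T₂ t s ρ : A) :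
    φ (rhoPolyVal T₁ T₂ t s ρ) = rhoPolyVal (φ T₁) (φ T₂) (φ t) (φ s) (φ ρ) := by
  simp [rhoPolyVal, map_ofNat]

open Polynomial in
theorem rhoPoly_map {A B : Type*} [CommRing A] [CommRing B] (φ : A →+* B) (T₁ T₂ t s : A) :
    (rhoPoly T₁ T₂ t s).map φ = rhoPoly (φ T₁) (φ T₂) (φ t) (φ s) := by
  rw [← coe_mapRingHom, rhoPoly, map_rhoPolyVal]
  simp [rhoPoly]

open Polynomial in
theorem aeval_rhoPoly {A B : Type*} [CommRing A] [CommRing B] [Algebra A B]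
    (T₁ T₂ t s : A) (ρ : B) :
    aeval ρ (rhoPoly T₁ T₂ t s) = rhoPolyVal (algebraMap A B T₁) (algebraMap A B T₂)
      (algebraMap A B t) (algebraMap A B s) ρ := by
  have h := map_rhoPolyVal (aeval ρ : A[X] →ₐ[A] B).toRingHom (C T₁) (C T₂) (C t) (C s) X
  simpa [rhoPoly] using h

open Polynomial in
theorem natDegree_rhoPoly_le {A : Type*} [CommRing A] (T₁ T₂ t s : A) :
    (rhoPoly T₁ T₂ t s).natDegree ≤ 12 := by
  simp only [rhoPoly, rhoPolyVal]
  compute_degree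

theorem rhoPolyVal_eq_of_seven_eq_zero {A : Type*} [CommRing A] (h7 : (7 : A) = 0) (x : A) :
    rhoPolyVal 1 3 4 1 x = 1 + x + 2 * x ^ 2 + 5 * x ^ 3 + 2 * x ^ 4 + 3 * x ^ 5 + 2 * x ^ 6 +
        3 * x ^ 7 + x ^ 9 + 5 * x ^ 10 + x ^ 11 + 6 * x ^ 12 := by
  simp only [rhoPolyVal]
  linear_combination (15984427145 - 51618417463 * x - 23684647726 * x ^ 2 + 93294729709 * x ^ 3 +
      64459042514 * x ^ 4 - 16901713317 * x ^ 5 - 21054497902 * x ^ 6 - 1298369189 * x ^ 7 +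
      2137611840 * x ^ 8 + 346435657 * x ^ 9 - 58472915 * x ^ 10 - 8681143 * x ^ 11 +
      849142 * x ^ 12) * h7

open Polynomial in
theorem natDegree_rhoPoly_seven : (rhoPoly (1 : ZMod 7) 3 4 1).natDegree = 12 := by
  have h7 : (7 : (ZMod 7)[X]) = 0 := by exact_mod_cast CharP.cast_eq_zero (ZMod 7)[X] 7
  have h := rhoPolyVal_eq_of_seven_eq_zero h7 X
  have h' : rhoPoly (1 : ZMod 7) 3 4 1 = rhoPolyVal 1 3 4 1 X := by
    simp only [rhoPoly, map_one, map_ofNat]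
  rw [h', h]
  compute_degree!

open Polynomial in
theorem irreducible_rhoPoly_seven : Irreducible (rhoPoly (1 : ZMod 7) 3 4 1) := by
  have _ : Fact (Nat.Prime 7) := ⟨by norm_num⟩
  have hdeg := natDegree_rhoPoly_seven
  set f := rhoPoly (1 : ZMod 7) 3 4 1 with hf
  have hf0 : f ≠ 0 := by rintro h; simp [h] at hdeg
  have hu : ¬ IsUnit f := fun h => by simp [natDegree_eq_zero_of_isUnit h] at hdeg
  -- an irreducible factor of degree at most `6` has a root in a field with `7 ^ j` elements
  have key : ∀ g : (ZMod 7)[X], Irreducible g → g ∣ f → 6 < g.natDegree := by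
    intro g hg hgf
    by_contra! hle
    have _ : Fact (Irreducible g) := ⟨hg⟩
    have hpos : 0 < g.natDegree := hg.natDegree_pos
    let pb := AdjoinRoot.powerBasis hg.ne_zero
    have _ : Module.Finite (ZMod 7) (AdjoinRoot g) := pb.finite
    have _ : Finite (AdjoinRoot g) := Module.finite_of_finite (ZMod 7)
    have _ : Fintype (AdjoinRoot g) := Fintype.ofFinite _
    have _ : CharP (AdjoinRoot g) 7 := charP_of_injective_algebraMap
      (algebraMap (ZMod 7) (AdjoinRoot g)).injective 7
    have hcard : Fintype.card (AdjoinRoot g) = 7 ^ g.natDegree := by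
      rw [Module.card_eq_pow_finrank (K := ZMod 7), ZMod.card, pb.finrank,
        AdjoinRoot.powerBasis_dim]
    set x := AdjoinRoot.root g
    have hx : x ^ 7 ^ g.natDegree = x := by rw [← hcard, FiniteField.pow_card]
    have hx' : ∀ i, x ^ 7 ^ (g.natDegree * i) = x := by
      intro i
      induction i with
      | zero => simp
      | succ i ih => rw [mul_add, mul_one, pow_add, pow_mul, ih, hx]
    have h7 : (7 : AdjoinRoot g) = 0 := by exact_mod_cast CharP.cast_eq_zero (AdjoinRoot g) 7
    have hroot : aeval x f = 0 := by
      rw [AdjoinRoot.aeval_eq]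
      exact AdjoinRoot.mk_eq_zero.2 hgf
    rw [hf, aeval_rhoPoly] at hroot
    simp only [map_one, map_ofNat] at hroot
    rw [rhoPolyVal_eq_of_seven_eq_zero h7] at hroot
    obtain ⟨h4, h5, h6⟩ := frobenius_iterate_ne x hroot
    interval_cases h : g.natDegree
    · exact h4 (hx' 4)
    · exact h4 (hx' 2)
    · exact h6 (hx' 2)
    · exact h4 hx
    · exact h5 hx
    · exact h6 hx
  refine ⟨hu, fun p q hpq => ?_⟩
  by_contra! h
  have hp0 : p ≠ 0 := by rintro rfl; simp at hpq; exact hf0 hpq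
  have hq0 : q ≠ 0 := by rintro rfl; simp at hpq; exact hf0 hpq
  have factor : ∀ r : (ZMod 7)[X], r ≠ 0 → ¬ IsUnit r → r ∣ f → 6 < r.natDegree := by
    intro r hr hru hrf
    obtain ⟨g, hg, hgr⟩ := WfDvdMonoid.exists_irreducible_factor hru hr
    exact (key g hg (hgr.trans hrf)).trans_le (natDegree_le_of_dvd hgr hr)
  have h1 := factor p hp0 h.1 ⟨q, hpq⟩
  have h2 := factor q hq0 h.2 ⟨p, by rw [hpq, mul_comm]⟩
  have h3 : f.natDegree = p.natDegree + q.natDegree := by rw [hpq, natDegree_mul hp0 hq0]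
  omega

open Polynomial in
theorem irreducible_rhoPoly_rat : Irreducible (rhoPoly (1 : ℚ) 3 4 1) := by
  have h : (rhoPoly (1 : ℤ) 3 4 1).map (Int.castRingHom (ZMod 7)) = rhoPoly (1 : ZMod 7) 3 4 1 := by
    rw [rhoPoly_map]; simp [map_ofNat]
  have _ : Fact (Nat.Prime 7) := ⟨by norm_num⟩
  have := irreducible_map_fraction_of_specialization (K := ℚ) (Int.castRingHom (ZMod 7))
    (rhoPoly (1 : ℤ) 3 4 1)
    (by rw [h, natDegree_rhoPoly_seven]; exact natDegree_rhoPoly_le _ _ _ _)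
    (by rw [h]; exact irreducible_rhoPoly_seven)
  rwa [rhoPoly_map, map_one, map_ofNat, map_ofNat] at this

open Polynomial in
theorem natDegree_rhoPoly_rat : (rhoPoly (1 : ℚ) 3 4 1).natDegree = 12 := by
  apply le_antisymm (natDegree_rhoPoly_le _ _ _ _)
  have h : (rhoPoly (1 : ℤ) 3 4 1).map (Int.castRingHom (ZMod 7)) = rhoPoly (1 : ZMod 7) 3 4 1 := by
    rw [rhoPoly_map]; simp [map_ofNat]
  have h2 : (rhoPoly (1 : ℤ) 3 4 1).map (Int.castRingHom ℚ) = rhoPoly (1 : ℚ) 3 4 1 := by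
    rw [rhoPoly_map]; simp [map_ofNat]
  rw [← h2, natDegree_map_eq_of_injective (Int.castRingHom ℚ).injective_int]
  rw [← natDegree_rhoPoly_seven, ← h]
  exact natDegree_map_le

open Polynomial MvPolynomial in
/-- The generic resolvent, with variables as coefficients. -/
theorem irreducible_rhoPoly_var :
    Irreducible (rhoPoly (var 0) (var 1) (var 3) (var 4)) := by
  let φ : MvPolynomial (Fin 6) ℚ →+* ℚ := (MvPolynomial.eval ![1, 3, 0, 4, 1, 0])
  have h : (rhoPoly (MvPolynomial.X 0 : MvPolynomial (Fin 6) ℚ) (MvPolynomial.X 1)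
      (MvPolynomial.X 3) (MvPolynomial.X 4)).map φ = rhoPoly (1 : ℚ) 3 4 1 := by
    rw [rhoPoly_map]; simp [φ]
  have := irreducible_map_fraction_of_specialization (K := RatField) φ _
    (by rw [h, natDegree_rhoPoly_rat]; exact natDegree_rhoPoly_le _ _ _ _)
    (by rw [h]; exact irreducible_rhoPoly_rat)
  rwa [rhoPoly_map] at this

theorem natDegree_rhoPoly_var :
    (rhoPoly (var 0) (var 1) (var 3) (var 4)).natDegree = 12 := by
  apply le_antisymm (natDegree_rhoPoly_le _ _ _ _)
  let φ : MvPolynomial (Fin 6) ℚ →+* ℚ := (MvPolynomial.eval ![1, 3, 0, 4, 1, 0])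
  have h : (rhoPoly (MvPolynomial.X 0 : MvPolynomial (Fin 6) ℚ) (MvPolynomial.X 1)
      (MvPolynomial.X 3) (MvPolynomial.X 4)).map φ = rhoPoly (1 : ℚ) 3 4 1 := by
    rw [rhoPoly_map]; simp [φ]
  have h2 : (rhoPoly (MvPolynomial.X 0 : MvPolynomial (Fin 6) ℚ) (MvPolynomial.X 1)
      (MvPolynomial.X 3) (MvPolynomial.X 4)).map (algebraMap _ RatField) =
      rhoPoly (var 0) (var 1) (var 3) (var 4) := by
    rw [rhoPoly_map]; rfl
  rw [← h2, Polynomial.natDegree_map_eq_of_injective (IsFractionRing.injective _ _),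
    ← natDegree_rhoPoly_rat, ← h]
  exact Polynomial.natDegree_map_le

section Slice

variable {K : Type*} [Field K]

theorem rhoPolyVal_eq_zero_of_invariants (u m n P y V G t s ρ T₁ T₂ D : K)
    (hD : D ^ 2 = y ^ 2 - 4 * n * P)
    (hVdef : V = n - 3 * P - y) (hGdef : G = 8 * n * P - y ^ 2 + y * (P + n))
    (hQ : u * m * D - n * u ^ 2 + P * m ^ 2 = y ^ 2)
    (hu : u ≠ 0) (hm : m ≠ 0) (hn : n ≠ 0) (hV : V ≠ 0) (hy : y ≠ 0) (hum : u + m ≠ 0)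
    (hum' : u - m ≠ 0)
    (hρ : ρ = (u - m) / (u + m)) (hT₁ : T₁ = (n * u + P * m) / (u - m))
    (hT₂ : T₂ = (n * u - P * m) / (u + m)) (ht : t = (P - 3 * n - y) / (n * V))
    (hs : s = (G * m + 4 * n * D * u) / (y * n * V)) :
    rhoPolyVal T₁ T₂ t s ρ = 0 ∧
    s ^ 2 * (ρ ^ 2 * T₁ - T₂) - (3 * (1 - ρ) * (1 + ρ) - 2 * t * (ρ ^ 2 * T₁ - T₂) -
        3 * t ^ 2 * (ρ * T₁ + T₂) * (ρ * T₁ - T₂)) =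
      2 * u * m * (P - n) * (s ^ 2 * n * V ^ 2 - 8 * G) / ((u + m) ^ 2 * n * V ^ 2) ∧
    D * (1 + ρ) * (1 - ρ) * (1 + ρ - t * (ρ * T₁ + T₂)) ^ 2 *
      (s ^ 2 * (ρ ^ 2 * T₁ - T₂) - (3 * (1 - ρ) * (1 + ρ) - 2 * t * (ρ ^ 2 * T₁ - T₂) -
        3 * t ^ 2 * (ρ * T₁ + T₂) * (ρ * T₁ - T₂))) =
    (ρ ^ 2 * T₁ - T₂) * (3 * (1 - ρ) * (1 + ρ) - 2 * t * (ρ ^ 2 * T₁ - T₂) -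
        3 * t ^ 2 * (ρ * T₁ + T₂) * (ρ * T₁ - T₂)) ^ 2 +
      ((1 + ρ + 3 * t * (ρ * T₁ + T₂)) ^ 2 * (ρ ^ 2 * T₁ - T₂) - 4 * (ρ * T₁ + T₂) * (1 - ρ) *
        ((1 + ρ) ^ 2 - t ^ 2 * (ρ * T₁ + T₂) ^ 2)) * (1 + ρ - t * (ρ * T₁ + T₂)) ^ 2 +
      2 * s ^ 2 * (ρ ^ 2 * T₁ - T₂) * (ρ ^ 2 * T₁ + T₂) * (1 + ρ - t * (ρ * T₁ + T₂)) ^ 2 := by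
  have hM : 1 + ρ = 2 * u / (u + m) := by rw [hρ]; field_simp; ring
  have hN : 1 - ρ = 2 * m / (u + m) := by rw [hρ]; field_simp; ring
  have hn' : ρ * T₁ + T₂ = 2 * n * u / (u + m) := by rw [hρ, hT₁, hT₂]; field_simp; ring
  have hP' : ρ * T₁ - T₂ = 2 * P * m / (u + m) := by rw [hρ, hT₁, hT₂]; field_simp; ring
  have hE : ρ ^ 2 * T₁ - T₂ = 2 * u * m * (P - n) / (u + m) ^ 2 := by
    rw [hρ, hT₁, hT₂]; field_simp; ring
  have hE' : ρ ^ 2 * T₁ + T₂ = 2 * (n * u ^ 2 - P * m ^ 2) / (u + m) ^ 2 := by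
    rw [hρ, hT₁, hT₂]; field_simp; ring
  have hDD : 1 + ρ - t * (ρ * T₁ + T₂) = 8 * u * (n - P) / ((u + m) * V) := by
    rw [hM, hn', ht]; field_simp; rw [hVdef]; ring
  have hq : 1 + ρ + 3 * t * (ρ * T₁ + T₂) = - 8 * u * (2 * n + y) / ((u + m) * V) := by
    rw [hM, hn', ht]; field_simp; rw [hVdef]; ring
  have hG : 3 * (1 - ρ) * (1 + ρ) - 2 * t * (ρ ^ 2 * T₁ - T₂) -
       3 * t ^ 2 * (ρ * T₁ + T₂) * (ρ * T₁ - T₂) =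
       16 * u * m * (P - n) * G / ((u + m) ^ 2 * n * V ^ 2) := by
    rw [hM, hN, hn', hP', hE, ht]; field_simp; rw [hVdef, hGdef]; ring
  have hΔ : (1 + ρ + 3 * t * (ρ * T₁ + T₂)) ^ 2 * (ρ ^ 2 * T₁ - T₂) -
      4 * (ρ * T₁ + T₂) * (1 - ρ) * ((1 + ρ) ^ 2 - t ^ 2 * (ρ * T₁ + T₂) ^ 2) =
     128 * u ^ 3 * m * (P - n) * D ^ 2 / ((u + m) ^ 4 * V ^ 2) := by
    rw [hq, hE, hn', hN, hM, ht, hD]; field_simp; rw [hVdef]; ring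
  have hs2 : s ^ 2 = (G * m + 4 * n * D * u) ^ 2 /
      ((u * m * D - n * u ^ 2 + P * m ^ 2) * n ^ 2 * V ^ 2) := by
    rw [hs, hQ]; field_simp
  have hQ0 : u * m * D - n * u ^ 2 + P * m ^ 2 ≠ 0 := by rw [hQ]; exact pow_ne_zero 2 hy
  have key : D * (1 + ρ) * (1 - ρ) * (1 + ρ - t * (ρ * T₁ + T₂)) ^ 2 *
      (s ^ 2 * (ρ ^ 2 * T₁ - T₂) - (3 * (1 - ρ) * (1 + ρ) - 2 * t * (ρ ^ 2 * T₁ - T₂) -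
        3 * t ^ 2 * (ρ * T₁ + T₂) * (ρ * T₁ - T₂))) =
    (ρ ^ 2 * T₁ - T₂) * (3 * (1 - ρ) * (1 + ρ) - 2 * t * (ρ ^ 2 * T₁ - T₂) -
        3 * t ^ 2 * (ρ * T₁ + T₂) * (ρ * T₁ - T₂)) ^ 2 +
      ((1 + ρ + 3 * t * (ρ * T₁ + T₂)) ^ 2 * (ρ ^ 2 * T₁ - T₂) - 4 * (ρ * T₁ + T₂) * (1 - ρ) *
        ((1 + ρ) ^ 2 - t ^ 2 * (ρ * T₁ + T₂) ^ 2)) * (1 + ρ - t * (ρ * T₁ + T₂)) ^ 2 +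
      2 * s ^ 2 * (ρ ^ 2 * T₁ - T₂) * (ρ ^ 2 * T₁ + T₂) * (1 + ρ - t * (ρ * T₁ + T₂)) ^ 2 := by
    rw [hG, hΔ, hDD, hM, hN, hE, hE', hs2]
    clear hG hΔ hDD hM hN hE hE' hs2 hs ht hQ hn' hP' hq hρ hT₁ hT₂ hVdef hGdef hD
    generalize hR : u * m * D - n * u ^ 2 + P * m ^ 2 = R at *
    field_simp
    rw [← hR]
    ring
  refine ⟨?_, by rw [hG, hE]; field_simp; ring, key⟩
  simp only [rhoPolyVal]
  rw [← key, hΔ, hG, hE, hDD, hM, hN]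
  field_simp
  ring

/-- The coordinates of the Pascals in the normal form `c = -b`, `f = -d` (the coordinate `s` of
`ℓ₁` and `ℓ₂` vanishes, and `T₁`, `T₂` are the inverses of the coordinates `t`), and the parameter
of which they determine the resolvent. -/
structure IsSlice (a b d e T₁ T₂ t s ρ : K) : Prop where
  T₁_eq : T₁ = (a * b * d + a * b * e + a * d * e - b * d * e) / (a - b - d - e)
  T₂_eq : T₂ = (a * b * d - a * b * e - a * d * e - b * d * e) / (a + b + d - e)
  t_eq : t = (-a * d + a * e - 3 * b * d - b * e) /
    (-a * b * d ^ 2 - 3 * a * b * d * e + b ^ 2 * d ^ 2 - b ^ 2 * d * e)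
  s_eq : s = (3 * a * b * d + a * b * e - a * d ^ 2 + a * d * e + b ^ 2 * d - b ^ 2 * e +
      b * d ^ 2 + 3 * b * d * e) /
    (-a * b * d ^ 2 - 3 * a * b * d * e + b ^ 2 * d ^ 2 - b ^ 2 * d * e)
  ρ_eq : ρ = (a - b - d - e) / (a + b + d - e)

/-- Nonvanishing conditions on the parameters. -/
structure IsGenericSlice (a b d e : K) : Prop where
  a_ne : a ≠ 0
  b_ne : b ≠ 0
  d_ne : d ≠ 0
  e_ne : e ≠ 0
  two_ne : (2 : K) ≠ 0
  u_ne : a - e ≠ 0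
  m_ne : b + d ≠ 0
  um_ne : a + b + d - e ≠ 0
  um_ne' : a - b - d - e ≠ 0
  V_ne : b * d - 3 * (a * e) - (a * d + b * e) ≠ 0
  y_ne : a * d + b * e ≠ 0
  nP_ne : b * d - a * e ≠ 0
  S_ne : 3 * a * b * d + a * b * e - a * d ^ 2 + a * d * e + b ^ 2 * d - b ^ 2 * e +
      b * d ^ 2 + 3 * b * d * e ≠ 0
  Y_ne : (3 * a * b * d + a * b * e - a * d ^ 2 + a * d * e + b ^ 2 * d - b ^ 2 * e +
      b * d ^ 2 + 3 * b * d * e) ^ 2 - 8 * (b * d) * (8 * (b * d) * (a * e) -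
      (a * d + b * e) ^ 2 + (a * d + b * e) * (a * e + b * d)) ≠ 0

variable {a b d e T₁ T₂ t s ρ : K}

theorem IsSlice.root_and_mem (h : IsSlice a b d e T₁ T₂ t s ρ) (hg : IsGenericSlice a b d e) :
    rhoPolyVal T₁ T₂ t s ρ = 0 ∧ ∀ W : Subfield K, T₁ ∈ W → T₂ ∈ W → t ∈ W → s ∈ W → ρ ∈ W →
      a ∈ W ∧ b ∈ W ∧ d ∈ W ∧ e ∈ W := by
  obtain ⟨hT₁, hT₂, ht, hs, hρ⟩ := h
  obtain ⟨ha, hb, hd, he, h2, hu, hm, hum, hum', hV, hy, hnP, hS, hY⟩ := hg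
  have hn : b * d ≠ 0 := mul_ne_zero hb hd
  have hV0 : -a * b * d ^ 2 - 3 * a * b * d * e + b ^ 2 * d ^ 2 - b ^ 2 * d * e =
    (b * d) * (b * d - 3 * (a * e) - (a * d + b * e)) := by ring
  rw [hV0] at ht hs
  obtain ⟨h1, hYe, h3⟩ := rhoPolyVal_eq_zero_of_invariants (a - e) (b + d) (b * d) (a * e)
    (a * d + b * e) (b * d - 3 * (a * e) - (a * d + b * e))
    (8 * (b * d) * (a * e) - (a * d + b * e) ^ 2 + (a * d + b * e) * (a * e + b * d))
    t s ρ T₁ T₂ (a * d - b * e) (by ring) rfl rfl (by ring) hu hm hn hV hy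
    (by convert hum using 1; ring) (by convert hum' using 1; ring)
    (by rw [hρ]; congr 1 <;> ring) (by rw [hT₁]; congr 1 <;> ring) (by rw [hT₂]; congr 1 <;> ring)
    (by rw [ht]; congr 1; ring) (by rw [hs]; field_simp; ring)
  refine ⟨h1, fun W wT₁ wT₂ wt ws wρ => ?_⟩
  have w1 : (1 : K) ∈ W := one_mem W
  have wN : ∀ k : ℕ, (k : K) ∈ W := natCast_mem W
  have w2 : (2 : K) ∈ W := by exact_mod_cast wN 2
  have w3 : (3 : K) ∈ W := by exact_mod_cast wN 3
  have w4 : (4 : K) ∈ W := by exact_mod_cast wN 4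
  have w8 : (8 : K) ∈ W := by exact_mod_cast wN 8
  have hM : 1 + ρ = 2 * (a - e) / (a + b + d - e) := by rw [hρ]; field_simp; ring
  have hN : 1 - ρ = 2 * (b + d) / (a + b + d - e) := by rw [hρ]; field_simp; ring
  have hM0 : 1 + ρ ≠ 0 := by rw [hM]; positivity
  have hN0 : 1 - ρ ≠ 0 := by rw [hN]; positivity
  have wM : 1 + ρ ∈ W := add_mem w1 wρ
  have wNN : 1 - ρ ∈ W := sub_mem w1 wρ
  have hn' : ρ * T₁ + T₂ = b * d * (1 + ρ) := by rw [hM, hρ, hT₁, hT₂]; field_simp; ring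
  have hP' : ρ * T₁ - T₂ = a * e * (1 - ρ) := by rw [hN, hρ, hT₁, hT₂]; field_simp; ring
  have wn : b * d ∈ W := by
    rw [eq_div_of_mul_eq hM0 hn'.symm]
    exact div_mem (add_mem (mul_mem wρ wT₁) wT₂) wM
  have wP : a * e ∈ W := by
    rw [eq_div_of_mul_eq hN0 hP'.symm]
    exact div_mem (sub_mem (mul_mem wρ wT₁) wT₂) wNN
  have wr : (b + d) / (a - e) ∈ W := by
    have : (b + d) / (a - e) = (1 - ρ) / (1 + ρ) := by rw [hM, hN]; field_simp
    rw [this]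
    exact div_mem wNN wM
  have htV : t * (b * d) * (b * d - 3 * (a * e) - (a * d + b * e)) =
      a * e - 3 * (b * d) - (a * d + b * e) := by
    rw [ht]
    generalize b * d - 3 * (a * e) - (a * d + b * e) = V at hV ⊢
    field_simp
    ring
  have htn : 1 - t * (b * d) = 4 * (b * d - a * e) / (b * d - 3 * (a * e) - (a * d + b * e)) := by
    rw [eq_div_iff hV]
    linear_combination -htV
  have hsV' : s * (b * d) * (b * d - 3 * (a * e) - (a * d + b * e)) =
      3 * a * b * d + a * b * e - a * d ^ 2 + a * d * e + b ^ 2 * d - b ^ 2 * e +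
        b * d ^ 2 + 3 * b * d * e := by
    rw [hs]
    generalize b * d - 3 * (a * e) - (a * d + b * e) = V at hV ⊢
    field_simp
  have h4 : (4 : K) ≠ 0 := by
    rw [show (4 : K) = 2 * 2 by norm_num]; exact mul_ne_zero h2 h2
  have htn0 : 1 - t * (b * d) ≠ 0 := by rw [htn]; positivity
  have wtn : 1 - t * (b * d) ∈ W := sub_mem w1 (mul_mem wt wn)
  have wy : a * d + b * e ∈ W := by
    have : (a * d + b * e) * (1 - t * (b * d)) =
        a * e - 3 * (b * d) - t * (b * d) * (b * d) + 3 * t * (b * d) * (a * e) := by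
      linear_combination htV
    rw [eq_div_of_mul_eq htn0 this]
    exact div_mem (add_mem (sub_mem (sub_mem wP (mul_mem w3 wn)) (mul_mem (mul_mem wt wn) wn))
      (mul_mem (mul_mem (mul_mem w3 wt) wn) wP)) wtn
  have wD : a * d - b * e ∈ W := by
    have wE : ρ ^ 2 * T₁ - T₂ ∈ W := sub_mem (mul_mem (pow_mem wρ 2) wT₁) wT₂
    have wE' : ρ ^ 2 * T₁ + T₂ ∈ W := add_mem (mul_mem (pow_mem wρ 2) wT₁) wT₂
    have wn' : ρ * T₁ + T₂ ∈ W := add_mem (mul_mem wρ wT₁) wT₂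
    have wP' : ρ * T₁ - T₂ ∈ W := sub_mem (mul_mem wρ wT₁) wT₂
    have wDD : 1 + ρ - t * (ρ * T₁ + T₂) ∈ W := sub_mem wM (mul_mem wt wn')
    have wG : 3 * (1 - ρ) * (1 + ρ) - 2 * t * (ρ ^ 2 * T₁ - T₂) -
        3 * t ^ 2 * (ρ * T₁ + T₂) * (ρ * T₁ - T₂) ∈ W :=
      sub_mem (sub_mem (mul_mem (mul_mem w3 wNN) wM) (mul_mem (mul_mem w2 wt) wE))
        (mul_mem (mul_mem (mul_mem w3 (pow_mem wt 2)) wn') wP')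
    have hY0 : s ^ 2 * (ρ ^ 2 * T₁ - T₂) - (3 * (1 - ρ) * (1 + ρ) - 2 * t * (ρ ^ 2 * T₁ - T₂) -
        3 * t ^ 2 * (ρ * T₁ + T₂) * (ρ * T₁ - T₂)) ≠ 0 := by
      rw [hYe]
      have hsV : s ^ 2 * (b * d) ^ 2 * (b * d - 3 * (a * e) - (a * d + b * e)) ^ 2 =
          (3 * a * b * d + a * b * e - a * d ^ 2 + a * d * e + b ^ 2 * d - b ^ 2 * e +
            b * d ^ 2 + 3 * b * d * e) ^ 2 := by
        rw [← hsV']; ring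
      have hne : s ^ 2 * (b * d) * (b * d - 3 * (a * e) - (a * d + b * e)) ^ 2 -
          8 * (8 * (b * d) * (a * e) - (a * d + b * e) ^ 2 +
            (a * d + b * e) * (a * e + b * d)) ≠ 0 := by
        intro h0
        apply hY
        rw [← hsV]
        linear_combination (b * d) * h0
      have hPn : a * e - b * d ≠ 0 := by rw [← neg_sub]; exact neg_ne_zero.2 hnP
      have hum2 : a - e + (b + d) ≠ 0 := by convert hum using 1; ring
      exact div_ne_zero (mul_ne_zero (mul_ne_zero (mul_ne_zero (mul_ne_zero h2 hu) hm) hPn) hne)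
        (mul_ne_zero (mul_ne_zero (pow_ne_zero 2 hum2) hn) (pow_ne_zero 2 hV))
    have hDD0 : 1 + ρ - t * (ρ * T₁ + T₂) ≠ 0 := by
      rw [hn', show 1 + ρ - t * (b * d * (1 + ρ)) = (1 + ρ) * (1 - t * (b * d)) by ring]
      exact mul_ne_zero hM0 htn0
    have hne := mul_ne_zero (mul_ne_zero (mul_ne_zero hM0 hN0) (pow_ne_zero 2 hDD0)) hY0
    simp only [mul_assoc (a * d - b * e)] at h3
    rw [eq_div_of_mul_eq hne h3]
    exact div_mem (add_mem (add_mem (mul_mem wE (pow_mem wG 2)) (mul_mem (sub_mem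
      (mul_mem (pow_mem (add_mem wM (mul_mem (mul_mem w3 wt) wn')) 2) wE)
      (mul_mem (mul_mem (mul_mem w4 wn') wNN)
        (sub_mem (pow_mem wM 2) (mul_mem (pow_mem wt 2) (pow_mem wn' 2))))) (pow_mem wDD 2)))
      (mul_mem (mul_mem (mul_mem (mul_mem w2 (pow_mem ws 2)) wE) wE') (pow_mem wDD 2)))
      (mul_mem (mul_mem (mul_mem wM wNN) (pow_mem wDD 2))
        (sub_mem (mul_mem (pow_mem ws 2) wE) wG))
  have wα : a * d ∈ W := by
    have : a * d = ((a * d + b * e) + (a * d - b * e)) / 2 := by field_simp; ring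
    rw [this]
    exact div_mem (add_mem wy wD) w2
  have wβ : b * e ∈ W := by
    have : b * e = ((a * d + b * e) - (a * d - b * e)) / 2 := by field_simp; ring
    rw [this]
    exact div_mem (sub_mem wy wD) w2
  have wl : (a - e) / (a * d + b * e) ∈ W := by
    have hSy : (3 * a * b * d + a * b * e - a * d ^ 2 + a * d * e + b ^ 2 * d - b ^ 2 * e +
        b * d ^ 2 + 3 * b * d * e) * (a * d + b * e) = (a - e) * ((b + d) / (a - e) *
        (8 * (b * d) * (a * e) - (a * d + b * e) ^ 2 +
          (a * d + b * e) * (a * e + b * d)) + 4 * (b * d) * (a * d - b * e)) := by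
      linear_combination (-(8 * (b * d) * (a * e) - (a * d + b * e) ^ 2 + (a * d + b * e) * (a * e +
          b * d))) * mul_div_cancel₀ (b + d) hu
    have hne := right_ne_zero_of_mul (hSy ▸ mul_ne_zero hS hy)
    have : (a - e) / (a * d + b * e) = s * (b * d * (b * d - 3 * (a * e) - (a * d + b * e))) /
        ((b + d) / (a - e) * (8 * (b * d) * (a * e) - (a * d + b * e) ^ 2 +
          (a * d + b * e) * (a * e + b * d)) + 4 * (b * d) * (a * d - b * e)) := by
      rw [div_eq_div_iff hy hne, ← hSy, ← hsV']
      ring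
    rw [this]
    refine div_mem (mul_mem ws (mul_mem wn (sub_mem (sub_mem wn (mul_mem w3 wP)) wy)))
      (add_mem (mul_mem wr (add_mem (sub_mem (mul_mem (mul_mem w8 wn) wP) (pow_mem wy 2))
        (mul_mem wy (add_mem wP wn)))) (mul_mem (mul_mem w4 wn) wD))
  have wd : d ∈ W := by
    have : d = (a - e) / (a * d + b * e) * ((b + d) / (a - e) * (a * d) - b * d) := by
      rw [div_mul_eq_mul_div, eq_div_iff hy, mul_sub, ← mul_assoc, mul_div_cancel₀ _ hu]
      ring
    rw [this]
    exact mul_mem wl (sub_mem (mul_mem wr wα) wn)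
  have wb : b ∈ W := by
    rw [← mul_div_cancel_right₀ b hd]
    exact div_mem wn wd
  refine ⟨?_, wb, wd, ?_⟩
  · rw [← mul_div_cancel_right₀ a hd]
    exact div_mem wα wd
  · rw [← mul_div_cancel_left₀ e hb]
    exact div_mem wβ wb

end Slice

/-- `SpecializesTo v x q`: the rational function `x` is defined at `v`, with value `q`. -/
def SpecializesTo (v : Fin 6 → ℚ) (x : RatField) (q : ℚ) : Prop :=
  ∃ f g : MvPolynomial (Fin 6) ℚ, MvPolynomial.eval v g ≠ 0 ∧
    x = algebraMap _ RatField f / algebraMap _ RatField g ∧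
    q = MvPolynomial.eval v f / MvPolynomial.eval v g

namespace SpecializesTo

variable {v : Fin 6 → ℚ} {x y : RatField} {q r : ℚ}

theorem algebraMap_ne_zero {g : MvPolynomial (Fin 6) ℚ} (h : MvPolynomial.eval v g ≠ 0) :
    algebraMap _ RatField g ≠ 0 := by
  refine (map_ne_zero_iff _ (IsFractionRing.injective _ _)).2 ?_
  rintro rfl
  simp at h

theorem ne_zero (h : SpecializesTo v x q) (hq : q ≠ 0) : x ≠ 0 := by
  obtain ⟨f, g, hg, rfl, rfl⟩ := h
  exact div_ne_zero (algebraMap_ne_zero (div_ne_zero_iff.1 hq).1) (algebraMap_ne_zero hg)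

theorem var (i : Fin 6) : SpecializesTo v (var i) (v i) :=
  ⟨MvPolynomial.X i, 1, by simp, by simp [_root_.var], by simp⟩

theorem of_eq (h : SpecializesTo v x q) (hq : q = r) : SpecializesTo v x r := hq ▸ h

theorem natCast (n : ℕ) : SpecializesTo v n n :=
  ⟨n, 1, by simp, by simp, by simp⟩

theorem one : SpecializesTo v 1 1 := by simpa using natCast (v := v) 1

theorem ofNat (n : ℕ) [n.AtLeastTwo] : SpecializesTo v (OfNat.ofNat n) (OfNat.ofNat n) := by
  simpa using natCast (v := v) (OfNat.ofNat n)

theorem add (hx : SpecializesTo v x q) (hy : SpecializesTo v y r) :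
    SpecializesTo v (x + y) (q + r) := by
  obtain ⟨f, g, hg, rfl, rfl⟩ := hx
  obtain ⟨f', g', hg', rfl, rfl⟩ := hy
  refine ⟨f * g' + g * f', g * g', by simpa using ⟨hg, hg'⟩, ?_, ?_⟩
  · rw [div_add_div _ _ (algebraMap_ne_zero hg) (algebraMap_ne_zero hg')]
    simp
  · rw [div_add_div _ _ hg hg']
    simp

theorem neg (hx : SpecializesTo v x q) : SpecializesTo v (-x) (-q) := by
  obtain ⟨f, g, hg, rfl, rfl⟩ := hx
  exact ⟨-f, g, hg, by simp [neg_div], by simp [neg_div]⟩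

theorem sub (hx : SpecializesTo v x q) (hy : SpecializesTo v y r) :
    SpecializesTo v (x - y) (q - r) := by
  simpa [sub_eq_add_neg] using hx.add hy.neg

theorem mul (hx : SpecializesTo v x q) (hy : SpecializesTo v y r) :
    SpecializesTo v (x * y) (q * r) := by
  obtain ⟨f, g, hg, rfl, rfl⟩ := hx
  obtain ⟨f', g', hg', rfl, rfl⟩ := hy
  exact ⟨f * f', g * g', by simpa using ⟨hg, hg'⟩, by simp [div_mul_div_comm],
    by simp [div_mul_div_comm]⟩

theorem pow (hx : SpecializesTo v x q) (n : ℕ) : SpecializesTo v (x ^ n) (q ^ n) := by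
  obtain ⟨f, g, hg, rfl, rfl⟩ := hx
  exact ⟨f ^ n, g ^ n, by simpa using fun h => absurd h hg, by simp [div_pow], by simp [div_pow]⟩

theorem div (hx : SpecializesTo v x q) (hy : SpecializesTo v y r) (hr : r ≠ 0) :
    SpecializesTo v (x / y) (q / r) := by
  obtain ⟨f, g, hg, rfl, rfl⟩ := hx
  obtain ⟨f', g', hg', rfl, rfl⟩ := hy
  exact ⟨f * g', g * f', by simpa using ⟨hg, (div_ne_zero_iff.1 hr).1⟩,
    by simp [div_div_div_eq], by simp [div_div_div_eq]⟩

end SpecializesTo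

theorem Subfield.closure_range_var : Subfield.closure (Set.range var) = ⊤ := by
  rw [eq_top_iff]
  intro z _
  obtain ⟨f, g, hg, rfl⟩ := IsFractionRing.div_surjective (A := MvPolynomial (Fin 6) ℚ) z
  have key (f : MvPolynomial (Fin 6) ℚ) :
      algebraMap _ RatField f ∈ Subfield.closure (Set.range var) := by
    induction f using MvPolynomial.induction_on with
    | C r =>
      rw [← MvPolynomial.algebraMap_eq, ← IsScalarTower.algebraMap_apply, eq_ratCast]
      exact SubfieldClass.ratCast_mem _ r
    | add p q hp hq => rw [map_add]; exact add_mem hp hq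
    | mul_X p i hp => rw [map_mul]; exact mul_mem hp (Subfield.subset_closure ⟨i, rfl⟩)
  exact div_mem (key f) (key g)

theorem fieldRange_eq_closure (φ : RatField →+* RatField) {y : Fin 6 → RatField}
    (h : ∀ i, φ (var i) = y i) : φ.fieldRange = Subfield.closure (Set.range y) := by
  rw [RingHom.fieldRange_eq_map, ← Subfield.closure_range_var, RingHom.map_field_closure,
    ← Set.range_comp]
  congr 2
  exact funext h

/-- The line which corresponds to `l` under the Möbius transformation
`x ↦ δ + κ * (1 + x) / (1 - x)` of the conic. -/
def moebiusLine (κ δ : RatField) (l : Fin 3 → RatField) : Fin 3 → RatField :=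
  ![l 0 * (κ - δ) ^ 2 - l 1 * ((κ + δ) * (κ - δ)) + l 2 * (κ + δ) ^ 2,
    2 * (κ - δ) * l 0 - 2 * δ * l 1 - 2 * (κ + δ) * l 2, l 0 + l 1 + l 2]

/-- The point which corresponds to `z` under the Möbius transformation
`x ↦ δ + κ * (1 + x) / (1 - x)` of the conic. -/
def moebiusPt (κ δ : RatField) (z : Fin 3 → RatField) : Fin 3 → RatField :=
  ![z 0 - 2 * z 1 + z 2, (κ + δ) * z 0 - 2 * δ * z 1 - (κ - δ) * z 2,
    (κ + δ) ^ 2 * z 0 + 2 * ((κ + δ) * (κ - δ)) * z 1 + (κ - δ) ^ 2 * z 2]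

/-- The Möbius transformation `x ↦ δ + κ * (1 + x) / (1 - x)`. -/
def moebius (κ δ x : RatField) : RatField := δ + κ * (1 + x) / (1 - x)

theorem cross_smul_smul (r r' : RatField) (u v : Fin 3 → RatField) :
    cross (r • u) (r' • v) = (r * r') • cross u v := by
  ext i
  fin_cases i <;> simp [cross] <;> ring

theorem moebiusLine_smul (κ δ r : RatField) (l : Fin 3 → RatField) :
    moebiusLine κ δ (r • l) = r • moebiusLine κ δ l := by
  ext i
  fin_cases i <;> simp [moebiusLine] <;> ring

theorem cross_moebiusPt (κ δ : RatField) (u v : Fin 3 → RatField) :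
    cross (moebiusPt κ δ u) (moebiusPt κ δ v) = (2 * κ) • moebiusLine κ δ (cross u v) := by
  ext i
  fin_cases i <;> simp [cross, moebiusLine, moebiusPt] <;> ring

theorem cross_moebiusLine (κ δ : RatField) (u v : Fin 3 → RatField) :
    cross (moebiusLine κ δ u) (moebiusLine κ δ v) = (2 * κ) • moebiusPt κ δ (cross u v) := by
  ext i
  fin_cases i <;> simp [cross, moebiusLine, moebiusPt] <;> ring

theorem conicPt_moebius (κ δ x : RatField) (hx : 1 - x ≠ 0) :
    conicPt (moebius κ δ x) = ((1 - x) ^ 2)⁻¹ • moebiusPt κ δ (conicPt x) := by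
  ext i
  fin_cases i <;> simp [conicPt, moebius, moebiusPt] <;> field_simp <;> ring

theorem pascalVec_moebius {κ δ x₁ x₂ x₃ y₁ y₂ y₃ r : RatField} {l : Fin 3 → RatField}
    (h : pascalVec x₁ x₂ x₃ y₁ y₂ y₃ = r • l) (hr : r ≠ 0) (hκ : κ ≠ 0)
    (hx₁ : 1 - x₁ ≠ 0) (hx₂ : 1 - x₂ ≠ 0) (hx₃ : 1 - x₃ ≠ 0)
    (hy₁ : 1 - y₁ ≠ 0) (hy₂ : 1 - y₂ ≠ 0) (hy₃ : 1 - y₃ ≠ 0) :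
    ∃ c : RatField, c ≠ 0 ∧ pascalVec (moebius κ δ x₁) (moebius κ δ x₂) (moebius κ δ x₃)
      (moebius κ δ y₁) (moebius κ δ y₂) (moebius κ δ y₃) = c • moebiusLine κ δ l := by
  simp only [pascalVec] at h
  simp only [pascalVec, conicPt_moebius, hx₁, hx₂, hx₃, hy₁, hy₂, hy₃, ne_eq, not_false_eq_true,
    cross_smul_smul, cross_moebiusPt, cross_moebiusLine, h, moebiusLine_smul, smul_smul]
  refine ⟨_, ?_, rfl⟩
  have := mul_ne_zero two_ne_zero hκ
  positivity

theorem sCoord_smul {c : RatField} (hc : c ≠ 0) (l : Fin 3 → RatField) :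
    sCoord (c • l) = sCoord l := mul_div_mul_left _ _ hc

theorem tCoord_smul {c : RatField} (hc : c ≠ 0) (l : Fin 3 → RatField) :
    tCoord (c • l) = tCoord l := mul_div_mul_left _ _ hc

theorem map_sCoord_pascalVec (φ : RatField →+* RatField) (x₁ x₂ x₃ y₁ y₂ y₃ : RatField) :
    φ (sCoord (pascalVec x₁ x₂ x₃ y₁ y₂ y₃)) =
      sCoord (pascalVec (φ x₁) (φ x₂) (φ x₃) (φ y₁) (φ y₂) (φ y₃)) := by
  simp [sCoord, pascalVec, cross, conicPt, map_div₀]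

theorem map_tCoord_pascalVec (φ : RatField →+* RatField) (x₁ x₂ x₃ y₁ y₂ y₃ : RatField) :
    φ (tCoord (pascalVec x₁ x₂ x₃ y₁ y₂ y₃)) =
      tCoord (pascalVec (φ x₁) (φ x₂) (φ x₃) (φ y₁) (φ y₂) (φ y₃)) := by
  simp [tCoord, pascalVec, cross, conicPt, map_div₀]

section Coordinates

variable {κ δ T₁ T₂ : RatField}

theorem coords_moebiusLine_mem {W : Subfield RatField} {l : Fin 3 → RatField} (hκ : κ ∈ W)
    (hδ : δ ∈ W) (h : ∀ i, l i ∈ W) :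
    sCoord (moebiusLine κ δ l) ∈ W ∧ tCoord (moebiusLine κ δ l) ∈ W := by
  have h2 : (2 : RatField) ∈ W := by exact_mod_cast natCast_mem W 2
  have hp := add_mem hκ hδ
  have hq := sub_mem hκ hδ
  have h0 : moebiusLine κ δ l 0 ∈ W := add_mem (sub_mem (mul_mem (h 0) (pow_mem hq 2))
    (mul_mem (h 1) (mul_mem hp hq))) (mul_mem (h 2) (pow_mem hp 2))
  exact ⟨div_mem (sub_mem (sub_mem (mul_mem (mul_mem h2 hq) (h 0)) (mul_mem (mul_mem h2 hδ) (h 1)))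
    (mul_mem (mul_mem h2 hp) (h 2))) h0, div_mem (add_mem (add_mem (h 0) (h 1)) (h 2)) h0⟩

/-- The coordinates of a line can be recovered from those of its image under a Möbius
transformation. -/
theorem coords_mem_of_moebiusLine {W : Subfield RatField} {l : Fin 3 → RatField} (hκ : κ ∈ W)
    (hδ : δ ∈ W) (hκ0 : κ ≠ 0) (h0 : moebiusLine κ δ l 0 ≠ 0)
    (hs : sCoord (moebiusLine κ δ l) ∈ W) (ht : tCoord (moebiusLine κ δ l) ∈ W) :
    ∃ r : RatField, r ≠ 0 ∧ ∀ i, r * l i ∈ W := by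
  have h1 := one_mem W
  have h2 : (2 : RatField) ∈ W := by exact_mod_cast natCast_mem W 2
  have hp := add_mem hκ hδ
  have hq := sub_mem hκ hδ
  refine ⟨4 * κ ^ 2 / moebiusLine κ δ l 0, div_ne_zero
    (mul_ne_zero (by norm_num) (pow_ne_zero 2 hκ0)) h0, fun i => ?_⟩
  fin_cases i
  · convert add_mem (add_mem h1 (mul_mem hs hp)) (mul_mem ht (pow_mem hp 2)) using 1
    simp only [sCoord, tCoord]
    field_simp
    simp [moebiusLine]
    ring
  · convert neg_mem (sub_mem (add_mem h2 (mul_mem hs (mul_mem h2 hδ)))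
      (mul_mem ht (mul_mem h2 (mul_mem hp hq)))) using 1
    simp only [sCoord, tCoord]
    field_simp
    simp [moebiusLine]
    ring
  · convert add_mem (sub_mem h1 (mul_mem hs hq)) (mul_mem ht (pow_mem hq 2)) using 1
    simp only [sCoord, tCoord]
    field_simp
    simp [moebiusLine]
    ring

theorem center_mem_of_moebiusLine {W : Subfield RatField} (hκ : κ ≠ 0) (hT : T₁ - T₂ ≠ 0)
    (h₁ : moebiusLine κ δ ![T₁, 0, 1] 0 ≠ 0) (h₂ : moebiusLine κ δ ![T₂, 0, 1] 0 ≠ 0)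
    (hs₁ : sCoord (moebiusLine κ δ ![T₁, 0, 1]) ∈ W)
    (ht₁ : tCoord (moebiusLine κ δ ![T₁, 0, 1]) ∈ W)
    (hs₂ : sCoord (moebiusLine κ δ ![T₂, 0, 1]) ∈ W)
    (ht₂ : tCoord (moebiusLine κ δ ![T₂, 0, 1]) ∈ W) : δ ∈ W ∧ κ ^ 2 ∈ W := by
  have hY₀ := sub_mem (mul_mem hs₁ ht₂) (mul_mem ht₁ hs₂)
  have hY₁ := sub_mem ht₁ ht₂
  have hY₂ := sub_mem hs₂ hs₁
  have e₀ : sCoord (moebiusLine κ δ ![T₁, 0, 1]) * tCoord (moebiusLine κ δ ![T₂, 0, 1]) -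
      tCoord (moebiusLine κ δ ![T₁, 0, 1]) * sCoord (moebiusLine κ δ ![T₂, 0, 1]) =
      4 * κ * (T₁ - T₂) /
        (moebiusLine κ δ ![T₁, 0, 1] 0 * moebiusLine κ δ ![T₂, 0, 1] 0) := by
    simp only [sCoord, tCoord]
    field_simp
    simp [moebiusLine]
    ring
  have e₁ : tCoord (moebiusLine κ δ ![T₁, 0, 1]) - tCoord (moebiusLine κ δ ![T₂, 0, 1]) =
      δ * (4 * κ * (T₁ - T₂) /
        (moebiusLine κ δ ![T₁, 0, 1] 0 * moebiusLine κ δ ![T₂, 0, 1] 0)) := by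
    simp only [tCoord]
    field_simp
    simp [moebiusLine]
    ring
  have e₂ : sCoord (moebiusLine κ δ ![T₂, 0, 1]) - sCoord (moebiusLine κ δ ![T₁, 0, 1]) =
      (δ ^ 2 - κ ^ 2) * (4 * κ * (T₁ - T₂) /
        (moebiusLine κ δ ![T₁, 0, 1] 0 * moebiusLine κ δ ![T₂, 0, 1] 0)) := by
    simp only [sCoord]
    field_simp
    simp [moebiusLine]
    ring
  rw [e₀] at hY₀
  rw [e₁] at hY₁
  rw [e₂] at hY₂
  have hr : 4 * κ * (T₁ - T₂) /
      (moebiusLine κ δ ![T₁, 0, 1] 0 * moebiusLine κ δ ![T₂, 0, 1] 0) ≠ 0 :=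
    div_ne_zero (mul_ne_zero (mul_ne_zero (by norm_num) hκ) hT) (mul_ne_zero h₁ h₂)
  have hδ : δ ∈ W := by simpa [hr] using div_mem hY₁ hY₀
  refine ⟨hδ, ?_⟩
  have := sub_mem (pow_mem hδ 2) (div_mem hY₂ hY₀)
  rwa [mul_div_cancel_right₀ _ hr, sub_sub_cancel] at this

end Coordinates

section NormalForm

/-- The inverse of the coordinate `t` of the first Pascal in normal form. -/
def sliceT₁ : RatField :=
  (var 0 * var 1 * var 3 + var 0 * var 1 * var 4 + var 0 * var 3 * var 4 - var 1 * var 3 * var 4) /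
    (var 0 - var 1 - var 3 - var 4)

/-- The inverse of the coordinate `t` of the second Pascal in normal form. -/
def sliceT₂ : RatField :=
  (var 0 * var 1 * var 3 - var 0 * var 1 * var 4 - var 0 * var 3 * var 4 - var 1 * var 3 * var 4) /
    (var 0 + var 1 + var 3 - var 4)

/-- The coordinate `t` of the third Pascal in normal form. -/
def sliceT : RatField :=
  (-var 0 * var 3 + var 0 * var 4 - 3 * var 1 * var 3 - var 1 * var 4) /
    (-var 0 * var 1 * var 3 ^ 2 - 3 * var 0 * var 1 * var 3 * var 4 + var 1 ^ 2 * var 3 ^ 2 -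
      var 1 ^ 2 * var 3 * var 4)

/-- The coordinate `s` of the third Pascal in normal form. -/
def sliceS : RatField :=
  (3 * var 0 * var 1 * var 3 + var 0 * var 1 * var 4 - var 0 * var 3 ^ 2 + var 0 * var 3 * var 4 +
      var 1 ^ 2 * var 3 - var 1 ^ 2 * var 4 + var 1 * var 3 ^ 2 + 3 * var 1 * var 3 * var 4) /
    (-var 0 * var 1 * var 3 ^ 2 - 3 * var 0 * var 1 * var 3 * var 4 + var 1 ^ 2 * var 3 ^ 2 -
      var 1 ^ 2 * var 3 * var 4)

/-- A root of the resolvent of the three Pascals in normal form. -/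
def sliceRho : RatField := (var 0 - var 1 - var 3 - var 4) / (var 0 + var 1 + var 3 - var 4)

theorem isSlice_var : IsSlice (var 0) (var 1) (var 3) (var 4) sliceT₁ sliceT₂ sliceT sliceS
    sliceRho := ⟨rfl, rfl, rfl, rfl, rfl⟩

/-- A point at which the rational functions of this section are defined and do not vanish. -/
def samplePoint : Fin 6 → ℚ := ![2, 3, 1, 5, 4, 2]

theorem specializesTo_var :
    SpecializesTo samplePoint (var 0) 2 ∧ SpecializesTo samplePoint (var 1) 3 ∧
    SpecializesTo samplePoint (var 2) 1 ∧ SpecializesTo samplePoint (var 3) 5 ∧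
    SpecializesTo samplePoint (var 4) 4 ∧ SpecializesTo samplePoint (var 5) 2 :=
  ⟨.var 0, .var 1, .var 2, .var 3, .var 4, .var 5⟩

theorem isGenericSlice_var : IsGenericSlice (var 0) (var 1) (var 3) (var 4) := by
  obtain ⟨h₀, h₁, h₂, h₃, h₄, h₅⟩ := specializesTo_var
  constructor
  case two_ne => norm_num
  all_goals
    apply SpecializesTo.ne_zero (v := samplePoint)
    · repeat' first
        | assumption | exact .one | exact .ofNat _ | with_reducible apply SpecializesTo.add
        | with_reducible apply SpecializesTo.sub | with_reducible apply SpecializesTo.neg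
        | with_reducible apply SpecializesTo.mul
        | with_reducible apply SpecializesTo.pow
    norm_num

theorem specializesTo_slice :
    SpecializesTo samplePoint sliceT₁ (-17 / 5) ∧
    SpecializesTo samplePoint sliceT₂ (-47 / 3) ∧
    SpecializesTo samplePoint sliceT (59 / 465) ∧
    SpecializesTo samplePoint sliceS (-368 / 465) := by
  obtain ⟨h₀, h₁, h₂, h₃, h₄, h₅⟩ := specializesTo_var
  refine ⟨?_, ?_, ?_, ?_⟩
  all_goals
    apply SpecializesTo.of_eq
    · apply SpecializesTo.div
      iterate 2
        rotate_right
        repeat' first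
          | assumption | exact .ofNat _ | with_reducible apply SpecializesTo.add
          | with_reducible apply SpecializesTo.sub | with_reducible apply SpecializesTo.neg
          | with_reducible apply SpecializesTo.mul | with_reducible apply SpecializesTo.pow
      norm_num
    norm_num

theorem rhoPolyVal_slice_ne_zero : rhoPolyVal sliceT₁ sliceT₂ sliceT sliceS 2 ≠ 0 := by
  obtain ⟨h₁, h₂, h₃, h₄⟩ := specializesTo_slice
  apply SpecializesTo.ne_zero (v := samplePoint)
  · simp only [rhoPolyVal]
    repeat' first
      | assumption | exact .one | exact .ofNat _
      | with_reducible apply SpecializesTo.add | with_reducible apply SpecializesTo.sub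
      | with_reducible apply SpecializesTo.mul
      | with_reducible apply SpecializesTo.pow
  norm_num

theorem moebiusLine_slice_ne_zero :
    moebiusLine (var 2) (var 5) ![sliceT₁, 0, 1] 0 ≠ 0 ∧
    moebiusLine (var 2) (var 5) ![sliceT₂, 0, 1] 0 ≠ 0 ∧
    moebiusLine (var 2) (var 5) ![1, sliceS, sliceT] 0 ≠ 0 ∧ sliceT₁ - sliceT₂ ≠ 0 := by
  obtain ⟨h₁, h₂, h₃, h₄⟩ := specializesTo_slice
  obtain ⟨g₀, g₁, g₂, g₃, g₄, g₅⟩ := specializesTo_var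
  simp only [moebiusLine, Matrix.cons_val, zero_mul, sub_zero]
  refine ⟨?_, ?_, ?_, ?_⟩
  all_goals
    apply SpecializesTo.ne_zero (v := samplePoint)
    · repeat' first
        | assumption | exact .one
        | with_reducible apply SpecializesTo.add | with_reducible apply SpecializesTo.sub
        | with_reducible apply SpecializesTo.mul
        | with_reducible apply SpecializesTo.pow
    norm_num

theorem factors_ne_zero : (var 2 ≠ 0) ∧ (1 - var 0 ≠ 0) ∧ (1 - var 1 ≠ 0) ∧ (1 - -var 1 ≠ 0) ∧
    (1 - var 3 ≠ 0) ∧ (1 - var 4 ≠ 0) ∧ (1 - -var 3 ≠ 0) ∧ (var 0 + var 1 ≠ 0) ∧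
    (var 3 - var 1 ≠ 0) ∧ (var 4 - var 3 ≠ 0) ∧ (var 3 - var 0 ≠ 0) ∧ (var 1 + var 4 ≠ 0) ∧
    (var 4 - var 1 ≠ 0) ∧ (-var 0 * var 1 * var 3 ^ 2 - 3 * var 0 * var 1 * var 3 * var 4 +
      var 1 ^ 2 * var 3 ^ 2 - var 1 ^ 2 * var 3 * var 4 ≠ 0) := by
  obtain ⟨h₀, h₁, h₂, h₃, h₄, h₅⟩ := specializesTo_var
  refine ⟨?_, ?_, ?_, ?_, ?_, ?_, ?_, ?_, ?_, ?_, ?_, ?_, ?_, ?_⟩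
  all_goals
    apply SpecializesTo.ne_zero (v := samplePoint)
    · repeat' first
        | assumption | exact .one | exact .ofNat _ | with_reducible apply SpecializesTo.add
        | with_reducible apply SpecializesTo.sub | with_reducible apply SpecializesTo.neg
        | with_reducible apply SpecializesTo.mul
        | with_reducible apply SpecializesTo.pow
    norm_num

end NormalForm

section Embeddings

theorem pascalVec_normalForm :
    (∃ r : RatField, r ≠ 0 ∧ pascalVec (var 0) (var 3) (var 1) (var 4) (-var 1) (-var 3) =
      r • ![sliceT₁, 0, 1]) ∧
    (∃ r : RatField, r ≠ 0 ∧ pascalVec (var 0) (-var 1) (-var 3) (var 4) (var 3) (var 1) =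
      r • ![sliceT₂, 0, 1]) ∧
    (∃ r : RatField, r ≠ 0 ∧ pascalVec (var 0) (var 1) (-var 1) (-var 3) (var 3) (var 4) =
      r • ![1, sliceS, sliceT]) := by
  obtain ⟨-, -, -, -, -, -, -, h₁, h₂, h₃, h₄, h₅, h₆, h₇⟩ := factors_ne_zero
  obtain ⟨ha, hb, hd, he, h2, -, hm, hum, hum', -⟩ := isGenericSlice_var
  refine ⟨⟨(var 0 + var 1) * (2 * var 1) * (var 3 - var 1) * (var 1 + var 3) * (var 4 - var 3) *
    (2 * var 3) * (var 0 - var 1 - var 3 - var 4), by positivity, ?_⟩,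
    ⟨2 * var 1 * (var 3 - var 0) * (var 3 - var 1) * (var 1 + var 3) * (var 1 + var 4) *
    (2 * var 3) * (var 0 + var 1 + var 3 - var 4), by positivity, ?_⟩,
    ⟨(var 3 - var 0) * (var 3 - var 1) * (var 1 + var 3) * (var 1 + var 3) * (var 4 - var 1) *
    (-var 0 * var 1 * var 3 ^ 2 - 3 * var 0 * var 1 * var 3 * var 4 +
      var 1 ^ 2 * var 3 ^ 2 - var 1 ^ 2 * var 3 * var 4), by positivity, ?_⟩⟩
  · ext i
    fin_cases i <;> simp [pascalVec, cross, conicPt, sliceT₁] <;> try field_simp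
    all_goals ring
  · ext i
    fin_cases i <;> simp [pascalVec, cross, conicPt, sliceT₂] <;> try field_simp
    all_goals ring
  · have hs := mul_div_cancel₀ (3 * var 0 * var 1 * var 3 + var 0 * var 1 * var 4 -
      var 0 * var 3 ^ 2 + var 0 * var 3 * var 4 + var 1 ^ 2 * var 3 - var 1 ^ 2 * var 4 +
      var 1 * var 3 ^ 2 + 3 * var 1 * var 3 * var 4) h₇
    have ht := mul_div_cancel₀ (-var 0 * var 3 + var 0 * var 4 - 3 * var 1 * var 3 -
      var 1 * var 4) h₇
    rw [← sliceS] at hs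
    rw [← sliceT] at ht
    ext i
    fin_cases i <;> simp only [pascalVec, cross, conicPt, Fin.zero_eta, Fin.mk_one,
      Fin.reduceFinMk, Pi.smul_apply, smul_eq_mul, Matrix.cons_val]
    · ring
    · linear_combination (-(var 3 - var 0) * (var 3 - var 1) * (var 1 + var 3) *
        (var 1 + var 3) * (var 4 - var 1)) * hs
    · linear_combination (-(var 3 - var 0) * (var 3 - var 1) * (var 1 + var 3) *
        (var 1 + var 3) * (var 4 - var 1)) * ht

/-- The six points of the conic, in terms of normal form parameters. -/
def moebiusPoints : Fin 6 → RatField :=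
  ![moebius (var 2) (var 5) (var 0), moebius (var 2) (var 5) (var 1),
    moebius (var 2) (var 5) (-var 1), moebius (var 2) (var 5) (var 3),
    moebius (var 2) (var 5) (var 4), moebius (var 2) (var 5) (-var 3)]

/-- The coordinates of the three Pascals in normal form, and the parameters of the Möbius
transformation. -/
def slicePoints : Fin 6 → RatField := ![sliceT₁, sliceT₂, var 2, sliceT, sliceS, var 5]

/-- Inversion of the parameters in normal form. -/
def inversionPoints : Fin 6 → RatField :=
  ![(var 0)⁻¹, (var 1)⁻¹, -var 2, (var 3)⁻¹, (var 4)⁻¹, var 5]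

theorem eq_top_of_var_mem {W : Subfield RatField} (h : ∀ i, var i ∈ W) : W = ⊤ := by
  rw [eq_top_iff, ← Subfield.closure_range_var, Subfield.closure_le]
  rintro _ ⟨i, rfl⟩
  exact h i

theorem mem_of_moebius_mem {κ δ x : RatField} {W : Subfield RatField} (hκ : κ ∈ W) (hδ : δ ∈ W)
    (h : moebius κ δ x ∈ W) (hκ0 : κ ≠ 0) (hx : 1 - x ≠ 0) : x ∈ W := by
  have e₁ : moebius κ δ x - δ - κ = x * (2 * κ / (1 - x)) := by
    simp only [moebius]; field_simp; ring
  have e₂ : moebius κ δ x - δ + κ = 2 * κ / (1 - x) := by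
    simp only [moebius]; field_simp; ring
  have h3 := div_mem (sub_mem (sub_mem h hδ) hκ) (add_mem (sub_mem h hδ) hκ)
  rwa [e₁, e₂, mul_div_cancel_right₀] at h3
  exact div_ne_zero (mul_ne_zero two_ne_zero hκ0) hx

theorem closure_moebiusPoints :
    var 2 ^ 2 ∈ Subfield.closure (Set.range moebiusPoints) ∧
    Subfield.closure (Set.range moebiusPoints) ⊔ Subfield.closure {var 2} = ⊤ := by
  obtain ⟨hκ, ha, hb, hc, hd, he, hf, -, hbd, -⟩ := factors_ne_zero
  have hB (i : Fin 6) : moebiusPoints i ∈ Subfield.closure (Set.range moebiusPoints) :=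
    Subfield.subset_closure ⟨i, rfl⟩
  generalize Subfield.closure (Set.range moebiusPoints) = W at hB
  have hb' : 1 + var 1 ≠ 0 := by rwa [sub_neg_eq_add] at hc
  have hd' : 1 + var 3 ≠ 0 := by rwa [sub_neg_eq_add] at hf
  have hbd' := isGenericSlice_var.m_ne
  have e₁ : moebiusPoints 1 + moebiusPoints 2 - moebiusPoints 3 - moebiusPoints 5 =
      4 * var 2 * (var 1 - var 3) * (var 1 + var 3) /
        ((1 - var 1) * (1 + var 1) * (1 - var 3) * (1 + var 3)) := by
    simp [moebiusPoints, moebius]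
    field_simp
    ring
  have e₂ : moebiusPoints 1 * moebiusPoints 2 - moebiusPoints 3 * moebiusPoints 5 =
      var 5 * (4 * var 2 * (var 1 - var 3) * (var 1 + var 3) /
        ((1 - var 1) * (1 + var 1) * (1 - var 3) * (1 + var 3))) := by
    simp [moebiusPoints, moebius]
    field_simp
    ring
  have hne : 4 * var 2 * (var 1 - var 3) * (var 1 + var 3) /
        ((1 - var 1) * (1 + var 1) * (1 - var 3) * (1 + var 3)) ≠ 0 := by
    have h4 : (4 : RatField) ≠ 0 := by norm_num
    have hbd'' : var 1 - var 3 ≠ 0 := by rw [← neg_sub]; exact neg_ne_zero.2 hbd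
    positivity
  have hδ : var 5 ∈ W := by
    have := div_mem (sub_mem (mul_mem (hB 1) (hB 2)) (mul_mem (hB 3) (hB 5)))
      (sub_mem (sub_mem (add_mem (hB 1) (hB 2)) (hB 3)) (hB 5))
    rwa [e₁, e₂, mul_div_cancel_right₀ _ hne] at this
  have e₃ : var 2 ^ 2 = (moebiusPoints 1 - var 5) * (moebiusPoints 2 - var 5) := by
    simp [moebiusPoints, moebius]
    field_simp
    ring
  refine ⟨e₃ ▸ mul_mem (sub_mem (hB 1) hδ) (sub_mem (hB 2) hδ), eq_top_of_var_mem ?_⟩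
  have hB' (i : Fin 6) := (le_sup_left : W ≤ W ⊔ Subfield.closure {var 2}) (hB i)
  have hδ' := (le_sup_left : W ≤ W ⊔ Subfield.closure {var 2}) hδ
  have hκ' := (le_sup_right : _ ≤ W ⊔ Subfield.closure {var 2}) (Subfield.subset_closure rfl)
  intro i
  fin_cases i
  · exact mem_of_moebius_mem hκ' hδ' (hB' 0) hκ ha
  · exact mem_of_moebius_mem hκ' hδ' (hB' 1) hκ hb
  · exact hκ'
  · exact mem_of_moebius_mem hκ' hδ' (hB' 3) hκ hd
  · exact mem_of_moebius_mem hκ' hδ' (hB' 4) hκ he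
  · exact hδ'

theorem exists_ringHom_moebiusPoints :
    ∃ φ : RatField →+* RatField, ∀ i, φ (var i) = moebiusPoints i := by
  obtain ⟨h₁, h₂⟩ := closure_moebiusPoints
  refine exists_ringHom_var _ (algebraicIndependent_of_isAlgebraic _ (var 2) ?_ h₂)
  refine IsIntegral.isAlgebraic (IsIntegral.of_pow two_pos ?_)
  exact isIntegral_algebraMap (x := (⟨_, h₁⟩ : Subfield.closure (Set.range moebiusPoints)))

theorem exists_ringHom_inversionPoints :
    ∃ ψ : RatField →+* RatField, ∀ i, ψ (var i) = inversionPoints i := by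
  refine exists_ringHom_var _ (algebraicIndependent_of_isAlgebraic _ 0 isAlgebraic_zero ?_)
  refine eq_top_of_var_mem fun i => SetLike.le_def.1 le_sup_left ?_
  have h (i : Fin 6) : inversionPoints i ∈ Subfield.closure (Set.range inversionPoints) :=
    Subfield.subset_closure ⟨i, rfl⟩
  fin_cases i
  · exact inv_mem_iff.1 (h 0)
  · exact inv_mem_iff.1 (h 1)
  · exact neg_mem_iff.1 (h 2)
  · exact inv_mem_iff.1 (h 3)
  · exact inv_mem_iff.1 (h 4)
  · exact h 5

theorem var_two_notMem : var 2 ∉ Subfield.closure (Set.range moebiusPoints) := by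
  obtain ⟨ψ, hψ⟩ := exists_ringHom_inversionPoints
  obtain ⟨hκ, ha, hb, hc, hd, he, hf, -⟩ := factors_ne_zero
  obtain ⟨ha0, hb0, hd0, he0, -⟩ := isGenericSlice_var
  have key (x : RatField) (hx : ψ x = x⁻¹) (hx0 : x ≠ 0) (hx1 : 1 - x ≠ 0) :
      ψ (moebius (var 2) (var 5) x) = moebius (var 2) (var 5) x := by
    have h2 : ψ (var 2) = -var 2 := hψ 2
    have h5 : ψ (var 5) = var 5 := hψ 5
    have hx2 : 1 - x⁻¹ ≠ 0 := by
      rw [sub_ne_zero] at hx1 ⊢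
      simpa [eq_comm] using hx1
    simp only [moebius, map_add, map_div₀, map_mul, map_sub, map_one, h2, h5, hx]
    have hx3 : x - 1 ≠ 0 := by rw [← neg_sub]; exact neg_ne_zero.2 hx1
    rw [add_right_inj, div_eq_div_iff hx2 hx1]
    field_simp
    ring
  have hle : Subfield.closure (Set.range moebiusPoints) ≤ ψ.eqLocusField (RingHom.id _) := by
    rw [Subfield.closure_le]
    rintro _ ⟨i, rfl⟩
    have hb1 : ψ (var 1) = (var 1)⁻¹ := hψ 1
    have hd1 : ψ (var 3) = (var 3)⁻¹ := hψ 3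
    fin_cases i
    · exact key _ (hψ 0) ha0 ha
    · exact key _ (hψ 1) hb0 hb
    · exact key _ (by rw [map_neg, hb1, inv_neg]) (neg_ne_zero.2 hb0) hc
    · exact key _ (hψ 3) hd0 hd
    · exact key _ (hψ 4) he0 he
    · exact key _ (by rw [map_neg, hd1, inv_neg]) (neg_ne_zero.2 hd0) hf
  intro h
  have h1 : ψ (var 2) = var 2 := hle h
  have h2 : ψ (var 2) = -var 2 := hψ 2
  exact hκ (self_eq_neg.1 (h1.symm.trans h2))

theorem closure_slicePoints :
    Subfield.closure (Set.range slicePoints) ⊔ Subfield.closure {sliceRho} = ⊤ := by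
  have h (i : Fin 6) : slicePoints i ∈
      Subfield.closure (Set.range slicePoints) ⊔ Subfield.closure {sliceRho} :=
    SetLike.le_def.1 le_sup_left (Subfield.subset_closure ⟨i, rfl⟩)
  obtain ⟨ha, hb, hd, he⟩ := (isSlice_var.root_and_mem isGenericSlice_var).2 _ (h 0) (h 1) (h 3)
    (h 4) (SetLike.le_def.1 le_sup_right (Subfield.subset_closure rfl))
  refine eq_top_of_var_mem fun i => ?_
  fin_cases i
  exacts [ha, hb, h 2, hd, he, h 5]

theorem exists_ringHom_slicePoints :
    ∃ θ : RatField →+* RatField, ∀ i, θ (var i) = slicePoints i := by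
  refine exists_ringHom_var _ (algebraicIndependent_of_isAlgebraic _ sliceRho ?_
    closure_slicePoints)
  let y (i : Fin 6) : Subfield.closure (Set.range slicePoints) :=
    ⟨slicePoints i, Subfield.subset_closure ⟨i, rfl⟩⟩
  refine ⟨rhoPoly (y 0) (y 1) (y 3) (y 4), fun h0 => rhoPolyVal_slice_ne_zero ?_, ?_⟩
  · have := aeval_rhoPoly (y 0) (y 1) (y 3) (y 4) (2 : RatField)
    rw [h0, map_zero] at this
    exact this.symm
  · rw [aeval_rhoPoly]
    exact (isSlice_var.root_and_mem isGenericSlice_var).1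

open Polynomial in
theorem relfinrank_slicePoints :
    Subfield.relfinrank (Subfield.closure (Set.range slicePoints)) ⊤ = 12 := by
  obtain ⟨θ, hθ⟩ := exists_ringHom_slicePoints
  have h := closure_slicePoints
  rw [← fieldRange_eq_closure θ hθ] at h ⊢
  let e := RingEquiv.ofBijective _ θ.rangeRestrictField_bijective
  rw [← h, ← natDegree_rhoPoly_var]
  rw [relfinrank_sup_closure_singleton θ.fieldRange sliceRho
    (mapEquiv e (rhoPoly (var 0) (var 1) (var 3) (var 4)))]
  · exact natDegree_map_eq_of_injective e.injective _
  · exact (MulEquiv.irreducible_iff (mapEquiv e)).2 irreducible_rhoPoly_var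
  · rw [mapEquiv_apply, rhoPoly_map, aeval_rhoPoly,
      ← (isSlice_var.root_and_mem isGenericSlice_var).1]
    congr 1
    exacts [hθ 0, hθ 1, hθ 3, hθ 4]

end Embeddings

section Tower

/-- The field generated by the coordinates of the three Pascals. -/
def pascalField : Subfield RatField :=
  Subfield.closure {sCoord line1, tCoord line1, sCoord line2, tCoord line2,
    sCoord lineStar, tCoord lineStar}

/-- The image of `pascalField` under the embedding which puts the points in normal form. -/
def normalFormField : Subfield RatField :=
  Subfield.closure {
    sCoord (moebiusLine (var 2) (var 5) ![sliceT₁, 0, 1]),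
    tCoord (moebiusLine (var 2) (var 5) ![sliceT₁, 0, 1]),
    sCoord (moebiusLine (var 2) (var 5) ![sliceT₂, 0, 1]),
    tCoord (moebiusLine (var 2) (var 5) ![sliceT₂, 0, 1]),
    sCoord (moebiusLine (var 2) (var 5) ![1, sliceS, sliceT]),
    tCoord (moebiusLine (var 2) (var 5) ![1, sliceS, sliceT])}

theorem map_pascalField {φ : RatField →+* RatField} (hφ : ∀ i, φ (var i) = moebiusPoints i) :
    pascalField.map φ = normalFormField := by
  obtain ⟨⟨r₁, hr₁, e₁⟩, ⟨r₂, hr₂, e₂⟩, ⟨r₃, hr₃, e₃⟩⟩ := pascalVec_normalForm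
  obtain ⟨hκ, ha, hb, hc, hd, he, hf, -⟩ := factors_ne_zero
  obtain ⟨c₁, hc₁, g₁⟩ := pascalVec_moebius (δ := var 5) e₁ hr₁ hκ ha hd hb he hc hf
  obtain ⟨c₂, hc₂, g₂⟩ := pascalVec_moebius (δ := var 5) e₂ hr₂ hκ ha hc hf he hd hb
  obtain ⟨c₃, hc₃, g₃⟩ := pascalVec_moebius (δ := var 5) e₃ hr₃ hκ ha hb hc hf hd he
  rw [pascalField, RingHom.map_field_closure]
  simp only [Set.image_insert_eq, Set.image_singleton, line1, line2, lineStar,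
    map_sCoord_pascalVec, map_tCoord_pascalVec, hφ, moebiusPoints, Matrix.cons_val, g₁, g₂, g₃,
    sCoord_smul hc₁, sCoord_smul hc₂, sCoord_smul hc₃, tCoord_smul hc₁, tCoord_smul hc₂,
    tCoord_smul hc₃, normalFormField]

theorem sq_var_two_mem_normalFormField :
    var 5 ∈ normalFormField ∧ var 2 ^ 2 ∈ normalFormField := by
  obtain ⟨hκ, -⟩ := factors_ne_zero
  obtain ⟨h₁, h₂, -, hT⟩ := moebiusLine_slice_ne_zero
  apply center_mem_of_moebiusLine hκ hT h₁ h₂ <;>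
    exact Subfield.subset_closure (by simp)

theorem normalFormField_sup :
    normalFormField ⊔ Subfield.closure {var 2} = Subfield.closure (Set.range slicePoints) := by
  obtain ⟨hκ, -⟩ := factors_ne_zero
  obtain ⟨h₁, h₂, h₃, -⟩ := moebiusLine_slice_ne_zero
  apply le_antisymm
  · have h (i : Fin 6) : slicePoints i ∈ Subfield.closure (Set.range slicePoints) :=
      Subfield.subset_closure ⟨i, rfl⟩
    have k₁ := coords_moebiusLine_mem (h 2) (h 5) (l := ![sliceT₁, 0, 1])
      (by intro i; fin_cases i; exacts [h 0, zero_mem _, one_mem _])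
    have k₂ := coords_moebiusLine_mem (h 2) (h 5) (l := ![sliceT₂, 0, 1])
      (by intro i; fin_cases i; exacts [h 1, zero_mem _, one_mem _])
    have k₃ := coords_moebiusLine_mem (h 2) (h 5) (l := ![1, sliceS, sliceT])
      (by intro i; fin_cases i; exacts [one_mem _, h 4, h 3])
    refine sup_le (Subfield.closure_le.2 ?_) (Subfield.closure_le.2 ?_)
    · rintro _ (rfl | rfl | rfl | rfl | rfl | rfl)
      exacts [k₁.1, k₁.2, k₂.1, k₂.2, k₃.1, k₃.2]
    · rintro _ rfl
      exact h 2
  · have hle : normalFormField ≤ normalFormField ⊔ Subfield.closure {var 2} := le_sup_left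
    have hκ' : var 2 ∈ normalFormField ⊔ Subfield.closure {var 2} :=
      SetLike.le_def.1 le_sup_right (Subfield.subset_closure rfl)
    have hδ' := hle sq_var_two_mem_normalFormField.1
    obtain ⟨r₁, hr₁, k₁⟩ := coords_mem_of_moebiusLine hκ' hδ' hκ h₁
      (hle (Subfield.subset_closure (by simp))) (hle (Subfield.subset_closure (by simp)))
    obtain ⟨r₂, hr₂, k₂⟩ := coords_mem_of_moebiusLine hκ' hδ' hκ h₂
      (hle (Subfield.subset_closure (by simp))) (hle (Subfield.subset_closure (by simp)))
    obtain ⟨r₃, hr₃, k₃⟩ := coords_mem_of_moebiusLine hκ' hδ' hκ h₃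
      (hle (Subfield.subset_closure (by simp))) (hle (Subfield.subset_closure (by simp)))
    rw [Subfield.closure_le]
    rintro _ ⟨i, rfl⟩
    have q₁ := div_mem (k₁ 0) (k₁ 2)
    have q₂ := div_mem (k₂ 0) (k₂ 2)
    have q₃ := div_mem (k₃ 2) (k₃ 0)
    have q₄ := div_mem (k₃ 1) (k₃ 0)
    rw [mul_div_mul_left _ _ (by assumption)] at q₁ q₂ q₃ q₄
    simp only [Matrix.cons_val, div_one] at q₁ q₂ q₃ q₄
    fin_cases i
    exacts [q₁, q₂, hκ', q₃, q₄, hδ']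

theorem finrank_pascalField : Module.finrank pascalField RatField = 12 := by
  obtain ⟨φ, hφ⟩ := exists_ringHom_moebiusPoints
  obtain ⟨hsq, htop⟩ := closure_moebiusPoints
  have hAB : normalFormField ≤ Subfield.closure (Set.range moebiusPoints) := by
    rw [← fieldRange_eq_closure φ hφ, ← map_pascalField hφ, RingHom.fieldRange_eq_map]
    exact (Subfield.gc_map_comap φ).monotone_l le_top
  have h₁ : Module.finrank pascalField RatField =
      Subfield.relfinrank normalFormField (Subfield.closure (Set.range moebiusPoints)) := by
    rw [← fieldRange_eq_closure φ hφ, ← map_pascalField hφ, RingHom.fieldRange_eq_map,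
      Subfield.relfinrank_map_map, Subfield.relfinrank_top_right]
  have h₂ := relfinrank_sup_closure_sqrt _ _ var_two_notMem hsq
  have h₃ := relfinrank_sup_closure_sqrt _ _ (fun h => var_two_notMem (hAB h))
    sq_var_two_mem_normalFormField.2
  have h₄ := relfinrank_slicePoints
  have h₅ := Subfield.relfinrank_mul_relfinrank hAB le_top
  have h₆ := Subfield.relfinrank_mul_relfinrank
    (le_sup_left : normalFormField ≤ normalFormField ⊔ Subfield.closure {var 2}) le_top
  rw [htop] at h₂
  rw [h₃, normalFormField_sup, h₄] at h₆
  rw [h₂] at h₅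
  omega

end Tower

/-- The field extension `K = ℚ(a,…,f)` over its subfield `ℚ(s₁, t₁, s₂, t₂, s⋆, t⋆)`
generated by the line coordinates of the Pascal lines `ℓ₁, ℓ₂, ℓ⋆` has degree
exactly `12`. -/
theorem pascal_stmt_4 :
    Module.finrank
      (Subfield.closure
        {sCoord line1, tCoord line1, sCoord line2, tCoord line2,
          sCoord lineStar, tCoord lineStar} : Subfield RatField) RatField = 12 := by
  exact finrank_pascalField

end
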